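/- arXiv:2007.00065 — 5 statements merged into one kernel-verified Lean document; each statement's English description precedes it below -/
import Mathlib

section
/- Let λ be a partition with r parts and degree sequence n_λ = (n_1, …, n_r), and let m ≥ 3 be an odd integer coprime to Δ(n_λ). Then the residues n_1 mod m, …, n_r mod m are pairwise distinct, hence the set {n_i mod m : 1 ≤ i ≤ r} is the degree sequence of a unique partition μ with r parts; moreover He_λ(x) ≡ x^{|λ| − |μ|} · He_μ(x) (mod m). -/
open Polynomial Finset

/-- Probabilists' Hermite polynomials over `ℤ`:
`He 0 = 1`, `He 1 = X`, `He (n+1) = X * He n - n * He (n-1)`. -/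
noncomputable def He : ℕ → Polynomial ℤ
  | 0 => 1
  | 1 => Polynomial.X
  | n + 2 => Polynomial.X * He (n + 1) - Polynomial.C ((n : ℤ) + 1) * He n

/-- The Wronskian `Wr[He_{n_1}, …, He_{n_r}]` of the Hermite polynomials indexed by
a degree sequence `ns : Fin r → ℕ`; entry `(i,j)` is the `i`-th derivative of `He (ns j)`. -/
noncomputable def wronskHe {r : ℕ} (ns : Fin r → ℕ) : Polynomial ℤ :=
  Matrix.det (Matrix.of fun i j : Fin r =>
    (fun q : Polynomial ℤ => Polynomial.derivative q)^[(i : ℕ)] (He (ns j)))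

/-- `Δ(n_λ) = ∏_{i<j} (n_j - n_i)`. -/
def vand {r : ℕ} (ns : Fin r → ℕ) : ℤ :=
  ∏ j : Fin r, ∏ i ∈ Finset.Iio j, ((ns j : ℤ) - (ns i : ℤ))

/-- The degree sequence `n_λ` of a partition `λ = (λ_1 ≥ … ≥ λ_r)`,
`n_i = λ_{r+1-i} + (i-1)` (indices shifted to start at `0`). -/
def degSeq {r : ℕ} (lam : Fin r → ℕ) : Fin r → ℕ :=
  fun i => lam i.rev + (i : ℕ)

/-- `d_λ` = (number of odd entries of the degree sequence) − (number of even entries). -/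
def dStat {r : ℕ} (ns : Fin r → ℕ) : ℤ :=
  ((Finset.univ.filter fun i => Odd (ns i)).card : ℤ) -
    ((Finset.univ.filter fun i => Even (ns i)).card : ℤ)

/-- `s_λ = d_λ(d_λ+1)/2`, the size of the 2-core of `λ`. -/
def sStat {r : ℕ} (ns : Fin r → ℕ) : ℕ :=
  (dStat ns * (dStat ns + 1) / 2).toNat

theorem derivative_He_succ (n : ℕ) :
    derivative (He (n + 1)) = C ((n : ℤ) + 1) * He n := by
  induction n using Nat.twoStepInduction with
  | zero => simp [He]
  | one => simp [He]; ring
  | more n h0 h1 =>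
    have e2 : He (n + 2) = X * He (n + 1) - C ((n : ℤ) + 1) * He n := rfl
    have e3 : He (n + 2 + 1) = X * He (n + 2) - C (((n + 1 : ℕ) : ℤ) + 1) * He (n + 1) := rfl
    rw [e3, derivative_sub, derivative_mul, derivative_C_mul, h0]
    have h1' : derivative (He (n + 2)) = C (((n + 1 : ℕ) : ℤ) + 1) * He (n + 1) := h1
    rw [h1', derivative_X, e2]
    simp only [Nat.cast_add, Nat.cast_one, Nat.cast_ofNat, map_add, map_one, map_natCast,
      map_ofNat]
    ring

theorem He_eq_hermite (n : ℕ) : He n = hermite n := by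
  induction n with
  | zero => simp [He]
  | succ n ih =>
    rw [hermite_succ, ← ih]
    cases n with
    | zero => simp [He]
    | succ n => rw [derivative_He_succ]; rfl

theorem dvd_doubleFactorial_mul_choose {m n k : ℕ} (hm : Odd m) (hn : n ≠ 0)
    (h : 2 * n + k = m) : m ∣ Nat.doubleFactorial (2 * n - 1) * Nat.choose m k := by
  obtain ⟨l, rfl⟩ := Nat.exists_eq_succ_of_ne_zero hn
  obtain ⟨p, rfl⟩ : ∃ p, m = p + 1 := ⟨m - 1, by omega⟩
  have hcop : Nat.Coprime (p + 1) (2 ^ (l + 1)) := (Nat.coprime_two_right.2 hm).pow_right _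
  refine hcop.dvd_of_dvd_mul_left ?_
  have hsymm : Nat.choose (p + 1) k = Nat.choose (p + 1) (2 * l + 1 + 1) :=
    Nat.choose_symm_of_eq_add (by omega)
  have hdf : Nat.factorial (l + 1) * (2 ^ (l + 1) * Nat.doubleFactorial (2 * l + 1)) =
      (2 * l + 1 + 1) * Nat.factorial (2 * l + 1) := by
    have h1 := Nat.factorial_eq_mul_doubleFactorial (2 * l + 1)
    have h2 := Nat.doubleFactorial_two_mul (l + 1)
    rw [show 2 * (l + 1) = 2 * l + 1 + 1 by ring] at h2
    rw [← Nat.factorial_succ, h1, h2]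
    ring
  obtain ⟨t, ht⟩ : Nat.factorial (l + 1) ∣ Nat.factorial (2 * l + 1) :=
    Nat.factorial_dvd_factorial (by omega)
  have hdf' : 2 ^ (l + 1) * Nat.doubleFactorial (2 * l + 1) = (2 * l + 1 + 1) * t := by
    apply Nat.eq_of_mul_eq_mul_left (Nat.factorial_pos (l + 1))
    rw [hdf, ht]
    ring
  have hch := Nat.add_one_mul_choose_eq p (2 * l + 1)
  rw [show 2 * (l + 1) - 1 = 2 * l + 1 by omega, hsymm, ← mul_assoc, hdf']
  refine ⟨Nat.choose p (2 * l + 1) * t, ?_⟩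
  rw [← mul_assoc, hch]
  ring

/-- The Hermite polynomial `He n` with coefficients reduced modulo `m`. -/
noncomputable def heMod (m n : ℕ) : (ZMod m)[X] :=
  (He n).map (Int.castRingHom (ZMod m))

theorem heMod_add_two (m n : ℕ) :
    heMod m (n + 2) = X * heMod m (n + 1) - ((n : (ZMod m)[X]) + 1) * heMod m n := by
  simp [heMod, He]

theorem heMod_self {m : ℕ} (hm : Odd m) : heMod m m = X ^ m := by
  ext k
  rw [heMod, He_eq_hermite, coeff_map, coeff_X_pow]
  rcases lt_trichotomy k m with hk | rfl | hk
  · rw [if_neg hk.ne]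
    by_cases hpar : Odd (m + k)
    · simp [coeff_hermite_of_odd_add hpar]
    · obtain ⟨n, hn⟩ : ∃ n, 2 * n + k = m := by
        obtain ⟨a, ha⟩ := Nat.not_odd_iff_even.1 hpar
        exact ⟨a - k, by omega⟩
      have hn0 : n ≠ 0 := by rintro rfl; omega
      have hc := coeff_hermite_explicit n k
      rw [hn] at hc
      obtain ⟨t, ht⟩ := dvd_doubleFactorial_mul_choose hm hn0 hn
      rw [hc, mul_assoc, ← Nat.cast_mul, ht]
      simp
  · simp
  · rw [if_neg hk.ne', coeff_hermite_of_lt hk, map_zero]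

theorem heMod_add_self {m : ℕ} (hm : Odd m) (n : ℕ) :
    heMod m (n + m) = X ^ m * heMod m n := by
  induction n using Nat.twoStepInduction with
  | zero => rw [zero_add, heMod_self hm]; simp [heMod, He]
  | one =>
    obtain ⟨p, rfl⟩ : ∃ p, m = p + 1 := ⟨m - 1, by have := hm.pos; omega⟩
    have hp : ((p : (ZMod (p + 1))[X]) + 1) = 0 := by
      exact_mod_cast CharP.cast_eq_zero ((ZMod (p + 1))[X]) (p + 1)
    rw [show 1 + (p + 1) = p + 2 by ring, heMod_add_two, hp, heMod_self hm]
    simp [heMod, He, mul_comm]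
  | more n h0 h1 =>
    have hm0 : (m : (ZMod m)[X]) = 0 := CharP.cast_eq_zero _ m
    rw [show n + 2 + m = n + m + 2 by ring, heMod_add_two,
      show n + m + 1 = n + 1 + m by ring, h0, h1, heMod_add_two, Nat.cast_add, hm0]
    ring

theorem heMod_add_mul {m : ℕ} (hm : Odd m) (n q : ℕ) :
    heMod m (n + m * q) = X ^ (m * q) * heMod m n := by
  induction q with
  | zero => simp
  | succ q ih =>
    rw [Nat.mul_succ, ← add_assoc, heMod_add_self hm, ih, pow_add]
    ring

theorem iterate_derivative_X_pow_mul_of_charP {R : Type*} [CommRing R] (m : ℕ) [CharP R m]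
    (q i : ℕ) (f : R[X]) :
    derivative^[i] (X ^ (m * q) * f) = X ^ (m * q) * derivative^[i] f := by
  induction i with
  | zero => rfl
  | succ i ih =>
    rw [Function.iterate_succ_apply', ih, Function.iterate_succ_apply', derivative_mul,
      derivative_X_pow]
    simp

theorem map_wronskHe {r : ℕ} (m : ℕ) (ns : Fin r → ℕ) :
    (wronskHe ns).map (Int.castRingHom (ZMod m)) =
      Matrix.det (Matrix.of fun i j : Fin r => derivative^[(i : ℕ)] (heMod m (ns j))) := by
  rw [wronskHe, ← coe_mapRingHom, RingHom.map_det]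
  congr 1
  ext1 i j
  simp only [RingHom.mapMatrix_apply, Matrix.map_apply, Matrix.of_apply, coe_mapRingHom, heMod]
  exact (iterate_derivative_map _ _ _).symm

theorem map_wronskHe_mod {r m : ℕ} (hm : Odd m) (ns : Fin r → ℕ) :
    (wronskHe ns).map (Int.castRingHom (ZMod m)) =
      X ^ (m * ∑ j, ns j / m) *
        (wronskHe fun j => ns j % m).map (Int.castRingHom (ZMod m)) := by
  rw [map_wronskHe, map_wronskHe, Finset.mul_sum, ← Finset.prod_pow_eq_pow_sum,
    ← Matrix.det_mul_row]
  congr 1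
  ext1 i j
  simp only [Matrix.of_apply]
  rw [← iterate_derivative_X_pow_mul_of_charP m, ← heMod_add_mul hm, Nat.mod_add_div]

theorem wronskHe_comp_perm {r : ℕ} (ns : Fin r → ℕ) (σ : Equiv.Perm (Fin r)) :
    wronskHe (ns ∘ σ) = C ((Equiv.Perm.sign σ : ℤ)) * wronskHe ns := by
  have h := Matrix.det_permute' σ (Matrix.of fun i j : Fin r =>
    (fun q : ℤ[X] => derivative q)^[(i : ℕ)] (He (ns j)))
  rw [wronskHe, wronskHe, eq_intCast C]
  exact h

theorem vand_eq_det {r : ℕ} (ns : Fin r → ℕ) :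
    vand ns = Matrix.det (Matrix.vandermonde fun i => (ns i : ℤ)) := by
  rw [Matrix.det_vandermonde, vand]
  exact Finset.prod_comm' (by simp)

theorem vand_comp_perm {r : ℕ} (ns : Fin r → ℕ) (σ : Equiv.Perm (Fin r)) :
    vand (ns ∘ σ) = (Equiv.Perm.sign σ : ℤ) * vand ns := by
  rw [vand_eq_det, vand_eq_det]
  exact Matrix.det_permute σ (Matrix.vandermonde fun i => (ns i : ℤ))

theorem cast_vand_mod {r : ℕ} (m : ℕ) (ns : Fin r → ℕ) :
    ((vand fun i => ns i % m : ℤ) : ZMod m) = (vand ns : ZMod m) := by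
  simp [vand]

theorem vand_eq_zero {r : ℕ} {ns : Fin r → ℕ} (h : ¬ Function.Injective ns) : vand ns = 0 := by
  rw [vand_eq_det, ← not_ne_iff, Matrix.det_vandermonde_ne_zero_iff]
  exact fun hinj => h fun i j hij => hinj (congrArg Nat.cast hij)

theorem exists_degSeq_eq {r : ℕ} {e : Fin r → ℕ} (he : StrictMono e) :
    ∃ mu : Fin r → ℕ, Antitone mu ∧ degSeq mu = e := by
  have key : ∀ d (i j : Fin r), (i : ℕ) + d = j → e i + d ≤ e j := by
    intro d
    induction d with
    | zero => intro i j h; rw [Fin.ext h, add_zero]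
    | succ d ih =>
      intro i j h
      have hj := j.isLt
      have h1 := ih i ⟨i + d, by omega⟩ rfl
      have h2 : e ⟨i + d, by omega⟩ < e j := he (Fin.lt_def.2 (by simp; omega))
      omega
  have hle : ∀ i : Fin r, (i : ℕ) ≤ e i := fun i => by
    have := key i ⟨0, by have := i.isLt; omega⟩ i (by simp)
    omega
  refine ⟨fun k => e k.rev - (k.rev : ℕ), fun i j hij => ?_, ?_⟩
  · have h : (j.rev : ℕ) ≤ i.rev := Fin.rev_le_rev.2 hij
    have := key ((i.rev : ℕ) - j.rev) j.rev i.rev (by omega)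
    simp only
    omega
  · funext i
    simp [degSeq, Nat.sub_add_cancel (hle i)]

theorem exists_perm_of_image_eq {r : ℕ} {f g : Fin r → ℕ} (hg : Function.Injective g)
    (h : Finset.univ.image f = Finset.univ.image g) :
    ∃ σ : Equiv.Perm (Fin r), g = f ∘ σ := by
  have hex : ∀ i, ∃ j, f j = g i := fun i => by
    have : g i ∈ Finset.univ.image f := h ▸ Finset.mem_image_of_mem g (Finset.mem_univ i)
    simpa using this
  choose s hs using hex
  have hinj : Function.Injective s := fun i j hij => hg (by rw [← hs, ← hs, hij])
  exact ⟨Equiv.ofBijective s (Finite.injective_iff_bijective.1 hinj), funext fun i => (hs i).symm⟩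

/-- Theorem `thm:hermitemodp`, Schur-type congruence.  Let `λ` be a
partition with `r` parts and `m ≥ 3` odd with `m` coprime to `Δ(n_λ)`.  Then the residues
`n_i mod m` are pairwise distinct; there is a (unique) partition `μ` with `r` parts whose
degree sequence is `{n_i mod m}`; and for any such `μ`,
`He_λ(x) ≡ x^{|λ|-|μ|} He_μ(x) (mod m)` coefficient-wise. -/
theorem stmt4 (r : ℕ) (lam : Fin r → ℕ) (hanti : Antitone lam)
    (m : ℕ) (hm3 : 3 ≤ m) (hmodd : Odd m)
    (hcop : IsCoprime (m : ℤ) (vand (degSeq lam)))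
    (HeL : Polynomial ℤ)
    (hHe : Polynomial.C (vand (degSeq lam)) * HeL = wronskHe (degSeq lam)) :
    (Function.Injective fun i : Fin r => degSeq lam i % m) ∧
    (∃ mu : Fin r → ℕ, Antitone mu ∧
      Finset.univ.image (degSeq mu) =
        Finset.univ.image (fun i : Fin r => degSeq lam i % m)) ∧
    (∀ mu : Fin r → ℕ, Antitone mu →
      Finset.univ.image (degSeq mu) =
        Finset.univ.image (fun i : Fin r => degSeq lam i % m) →
      ∀ HeM : Polynomial ℤ,
        Polynomial.C (vand (degSeq mu)) * HeM = wronskHe (degSeq mu) →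
        ∀ j : ℕ,
          (m : ℤ) ∣ (HeL - Polynomial.X ^ (∑ i, lam i - ∑ i, mu i) * HeM).coeff j) := by
  have hunit : IsUnit ((vand (degSeq lam) : ℤ) : ZMod m) := by
    have h := hcop.map (Int.castRingHom (ZMod m))
    simpa [isCoprime_zero_left] using h
  have : Fact (1 < m) := ⟨by omega⟩
  have hinj : Function.Injective fun i : Fin r => degSeq lam i % m := by
    by_contra hne
    apply hunit.ne_zero
    rw [← cast_vand_mod, vand_eq_zero hne, Int.cast_zero]
  refine ⟨hinj, ?_, ?_⟩
  · have hcard : (Finset.univ.image fun i : Fin r => degSeq lam i % m).card = r := by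
      rw [Finset.card_image_of_injective _ hinj, Finset.card_univ, Fintype.card_fin]
    obtain ⟨mu, hmu, hdeg⟩ := exists_degSeq_eq (Finset.orderEmbOfFin _ hcard).strictMono
    exact ⟨mu, hmu, by rw [hdeg, Finset.image_orderEmbOfFin_univ]⟩
  · intro mu hmu himg HeM hM j
    obtain ⟨σ, hσ⟩ := exists_perm_of_image_eq hinj himg
    have hexp : ∑ i, lam i - ∑ i, mu i = m * ∑ j, degSeq lam j / m := by
      have h1 : ∑ i, degSeq lam i = m * ∑ j, degSeq lam j / m + ∑ i, degSeq lam i % m := by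
        rw [Finset.mul_sum, ← Finset.sum_add_distrib]
        exact Finset.sum_congr rfl fun i _ => (Nat.div_add_mod _ _).symm
      have h2 : ∑ i, degSeq lam i % m = ∑ i, degSeq mu i := by
        rw [hσ]
        exact Equiv.sum_comp σ (degSeq mu)
      have h3 : ∀ nu : Fin r → ℕ, ∑ i, degSeq nu i = ∑ i, nu i + ∑ i : Fin r, (i : ℕ) := by
        intro nu
        simp only [degSeq, Finset.sum_add_distrib]
        exact congrArg (· + _) (Equiv.sum_comp Fin.revPerm nu)
      rw [h2, h3, h3] at h1
      omega
    rw [hexp]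
    have hv : ((vand (degSeq lam) : ℤ) : ZMod m) =
        ((Equiv.Perm.sign σ : ℤ) : ZMod m) * ((vand (degSeq mu) : ℤ) : ZMod m) := by
      rw [← cast_vand_mod, hσ, vand_comp_perm, Int.cast_mul]
    have hL := congrArg (Polynomial.map (Int.castRingHom (ZMod m))) hHe
    have hR := congrArg (Polynomial.map (Int.castRingHom (ZMod m))) hM
    rw [map_wronskHe_mod hmodd, hσ, wronskHe_comp_perm, Polynomial.map_mul, Polynomial.map_mul,
      ← hR, Polynomial.map_mul, map_C, map_C, map_C, eq_intCast, eq_intCast, eq_intCast] at hL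
    have heq : HeL.map (Int.castRingHom (ZMod m)) =
        X ^ (m * ∑ j, degSeq lam j / m) * HeM.map (Int.castRingHom (ZMod m)) := by
      apply (hunit.map C).mul_left_cancel
      rw [hL, hv, C_mul]
      ring
    rw [← ZMod.intCast_zmod_eq_zero_iff_dvd, ← eq_intCast (Int.castRingHom (ZMod m)),
      ← coeff_map, Polynomial.map_sub, heq]
    simp
end

section
/- For every odd integer m ≥ 3 and every integer n ≥ 0, the probabilists' Hermite polynomials satisfy He_{n+m}(x) ≡ x^m · He_n(x) (mod m). -/
open Polynomial Finset

open scoped Nat in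
theorem two_pow_mul_doubleFactorial_mul_choose (k j : ℕ) :
    2 ^ (k + 1) * ((2 * k + 1)‼ * (2 * (k + 1) + j).choose j) =
      (2 * (k + 1) + j).choose (k + 1) * (k + 1 + j).descFactorial (k + 1) := by
  have h1 : (2 * (k + 1))! = 2 ^ (k + 1) * (k + 1)! * (2 * k + 1)‼ := by
    rw [← Nat.doubleFactorial_two_mul]
    exact Nat.factorial_eq_mul_doubleFactorial (2 * k + 1)
  have h2 := Nat.add_choose_mul_factorial_mul_factorial (2 * (k + 1)) j
  have h3 := Nat.add_choose_mul_factorial_mul_factorial (k + 1) (k + 1 + j)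
  have h4 := Nat.factorial_mul_descFactorial (show k + 1 ≤ k + 1 + j by omega)
  have h5 : (2 * (k + 1) + j).choose (k + 1) = (2 * (k + 1) + j).choose (k + 1 + j) :=
    Nat.choose_symm_of_eq_add (by ring)
  have h6 : k + 1 + (k + 1 + j) = 2 * (k + 1) + j := by ring
  rw [Nat.add_sub_cancel_left] at h4
  rw [h6] at h3
  have hpos : 0 < (k + 1)! * j ! := by positivity
  apply Nat.eq_of_mul_eq_mul_right hpos
  calc _ = (2 * (k + 1) + j).choose j * (2 * (k + 1))! * j ! := by rw [h1]; ring
    _ = (2 * (k + 1) + j)! := h2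
    _ = _ := by rw [← h3, ← h4, h5]; ring

open scoped Nat in
theorem dvd_doubleFactorial_mul_choose_of_odd {k j : ℕ} (h : Odd (2 * (k + 1) + j)) :
    2 * (k + 1) + j ∣ (2 * k + 1)‼ * (2 * (k + 1) + j).choose j := by
  have hcop : Nat.Coprime (2 * (k + 1) + j) (2 ^ (k + 1)) :=
    (Nat.coprime_two_right.mpr h).pow_right _
  apply hcop.dvd_of_dvd_mul_left
  have hdesc : (k + 1 + j).descFactorial (k + 1) = (k + 1 + j) * (k + j).descFactorial k := by
    rw [show k + 1 + j = k + j + 1 by ring, Nat.succ_descFactorial_succ]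
  have hchoose : (2 * (k + 1) + j) * (2 * k + 1 + j).choose (k + 1) =
      (2 * (k + 1) + j).choose (k + 1) * (k + 1 + j) := by
    have := Nat.add_one_mul_choose_eq (2 * k + 1 + j) (k + j)
    rw [← Nat.choose_symm_of_eq_add (show 2 * k + 1 + j = (k + j) + (k + 1) by ring),
      ← Nat.choose_symm_of_eq_add
        (show 2 * (k + 1) + j = (k + 1 + j) + (k + 1) by ring)]
    rwa [show 2 * k + 1 + j + 1 = 2 * (k + 1) + j by ring,
      show k + j + 1 = k + 1 + j by ring] at this
  rw [two_pow_mul_doubleFactorial_mul_choose, hdesc, ← mul_assoc, ← hchoose, mul_assoc]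
  exact dvd_mul_right _ _

/-- The Appell property of the Hermite polynomials. -/
theorem derivative_hermite_succ (n : ℕ) :
    derivative (hermite (n + 1)) = C ((n : ℤ) + 1) * hermite n := by
  induction n with
  | zero => simp
  | succ n ih =>
    rw [hermite_succ (n + 1), ih, derivative_sub, derivative_mul, derivative_X, ih,
      derivative_C_mul, hermite_succ n]
    simp only [Nat.cast_add, Nat.cast_one, map_add, map_one]
    ring

theorem C_dvd_hermite_sub_X_pow {m : ℕ} (hm : Odd m) : C (m : ℤ) ∣ hermite m - X ^ m := by
  rw [C_dvd_iff_dvd_coeff]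
  intro j
  rw [coeff_sub, coeff_X_pow]
  rcases lt_trichotomy j m with hj | rfl | hj
  · rw [if_neg hj.ne, sub_zero]
    rcases Nat.even_or_odd (m + j) with he | ho
    · obtain ⟨k, rfl⟩ : ∃ k, m = 2 * (k + 1) + j := by
        obtain ⟨r, hr⟩ := he
        exact ⟨r - j - 1, by omega⟩
      rw [coeff_hermite_explicit, mul_assoc]
      exact dvd_mul_of_dvd_right
        (by exact_mod_cast dvd_doubleFactorial_mul_choose_of_odd hm) _
    · simp [coeff_hermite_of_odd_add ho]
  · simp
  · simp [coeff_hermite_of_lt hj, hj.ne']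

theorem C_dvd_He_add_sub {m : ℕ} (hm : Odd m) (n : ℕ) :
    C (m : ℤ) ∣ He (n + m) - X ^ m * He n := by
  induction n using He.induct with
  | case1 => simpa [He, He_eq_hermite] using C_dvd_hermite_sub_X_pow hm
  | case2 =>
    obtain ⟨k, rfl⟩ := Nat.exists_eq_add_of_le' hm.pos
    obtain ⟨q, hq⟩ := C_dvd_hermite_sub_X_pow hm
    refine ⟨X * q - hermite k, ?_⟩
    rw [← He_eq_hermite] at hq ⊢
    rw [show 1 + (k + 1) = k + 2 by ring, He, He]
    push_cast at hq ⊢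
    linear_combination X * hq
  | case3 n ih1 ih2 =>
    obtain ⟨p, hp⟩ := ih1
    obtain ⟨q, hq⟩ := ih2
    refine ⟨X * p - He (n + m) - C ((n : ℤ) + 1) * q, ?_⟩
    rw [show n + 2 + m = n + m + 2 by ring, He, He]
    rw [show n + 1 + m = n + m + 1 by ring] at hp
    simp only [Nat.cast_add, map_add, map_one] at hp hq ⊢
    linear_combination X * hp - (C (n : ℤ) + 1) * hq

/-- Carlitz's congruence.  For every odd `m ≥ 3` and every `n ≥ 0`,
`He_{n+m}(x) ≡ x^m · He_n(x) (mod m)` coefficient-wise. -/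
theorem stmt5 (m : ℕ) (hm3 : 3 ≤ m) (hmodd : Odd m) (n : ℕ) :
    ∀ j : ℕ, (m : ℤ) ∣ (He (n + m) - Polynomial.X ^ m * He n).coeff j := by
  exact (C_dvd_iff_dvd_coeff _ _).mp (C_dvd_He_add_sub hmodd n)
end

section
/- Let n ≥ k ≥ 1 and let λ = (n, k, k−1, …, 2, 1) (the partition with parts n, k, k−1, …, 1). (i) If n − k is odd, then every non-zero complex root of He_λ(x) is real and simple, and the number of distinct non-zero roots of He_λ is n − k − 1. (ii) If n − k is even, then every non-zero complex root of He_λ(x) is simple, exactly n − k of the non-zero roots are real, and exactly 2k of them are non-real. -/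
open Polynomial Finset

theorem X_pow_mul_iterate_derivative_X_pow (n i : ℕ) :
    (X : ℤ[X]) ^ i * derivative^[i] (X ^ n) = X ^ n * C ((n.descFactorial i : ℕ) : ℤ) := by
  rw [iterate_derivative_X_pow_eq_C_mul]
  rcases le_or_gt i n with h | h
  · obtain ⟨d, rfl⟩ := Nat.exists_eq_add_of_le h
    rw [Nat.add_sub_cancel_left, pow_add]
    ring
  · simp [Nat.descFactorial_of_lt h]

/-- The Wronskian of a family of integer polynomials. -/
noncomputable def derivWronskian {r : ℕ} (f : Fin r → ℤ[X]) : ℤ[X] :=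
  Matrix.det (Matrix.of fun i j : Fin r => derivative^[(i : ℕ)] (f j))

theorem wronskHe_eq {r : ℕ} (ns : Fin r → ℕ) :
    wronskHe ns = derivWronskian fun j => hermite (ns j) := by
  simp only [wronskHe, derivWronskian, He_eq_hermite]

theorem det_descFactorial {r : ℕ} (ns : Fin r → ℕ) :
    Matrix.det (Matrix.of fun i j : Fin r => (((ns j).descFactorial i : ℕ) : ℤ)) = vand ns := by
  have h := Matrix.det_eval_matrixOfPolynomials_eq_det_vandermonde (fun j => (ns j : ℤ))
    (fun i => descPochhammer ℤ i) (fun i => descPochhammer_natDegree ℤ i)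
    (fun i => monic_descPochhammer ℤ i)
  simp only [descPochhammer_eval_eq_descFactorial, Matrix.det_vandermonde] at h
  rw [← Matrix.det_transpose, vand]
  refine h.symm.trans ?_
  refine Finset.prod_comm' ?_
  simp

theorem X_pow_mul_derivWronskian_X_pow {r : ℕ} (ns : Fin r → ℕ) :
    (∏ i : Fin r, (X : ℤ[X]) ^ (i : ℕ)) * derivWronskian (fun j => X ^ ns j)
      = (∏ i, X ^ ns i) * C (vand ns) := by
  rw [derivWronskian, ← Matrix.det_mul_column, ← det_descFactorial, RingHom.map_det,
    ← Matrix.det_mul_row]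
  congr 1
  ext1 i j
  simp [X_pow_mul_iterate_derivative_X_pow]

theorem derivWronskian_change {r : ℕ} (f g : Fin r → ℤ[X]) (U : Matrix (Fin r) (Fin r) ℤ)
    (h : ∀ j, f j = ∑ l, C (U l j) * g l) : derivWronskian f = derivWronskian g * C U.det := by
  rw [derivWronskian, derivWronskian, RingHom.map_det, ← Matrix.det_mul]
  congr 1
  ext1 i j
  simp only [Matrix.mul_apply, h, iterate_derivative_sum, iterate_derivative_C_mul,
    Matrix.of_apply, RingHom.mapMatrix_apply, Matrix.map_apply]
  exact Finset.sum_congr rfl fun l _ => mul_comm _ _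

theorem exists_derivWronskian_snoc {r : ℕ} (g : Fin r → ℤ[X]) :
    ∃ A : Fin (r + 1) → ℤ[X], ∀ f,
      derivWronskian (Fin.snoc g f : Fin (r + 1) → ℤ[X]) = ∑ i, A i * derivative^[(i : ℕ)] f := by
  refine ⟨fun i => (-1) ^ (i + r : ℕ) * Matrix.det (Matrix.of fun a b : Fin r =>
    derivative^[(i.succAbove a : ℕ)] (g b)), fun f => ?_⟩
  rw [derivWronskian, Matrix.det_succ_column _ (Fin.last r)]
  refine Finset.sum_congr rfl fun i _ => ?_
  have : (Matrix.of fun i j : Fin (r + 1) =>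
      derivative^[(i : ℕ)] ((Fin.snoc g f : Fin (r + 1) → ℤ[X]) j)).submatrix i.succAbove
        (Fin.last r).succAbove
      = Matrix.of fun a b : Fin r => derivative^[(i.succAbove a : ℕ)] (g b) := by
    ext1 a b
    simp
  rw [this]
  simp
  ring

theorem odd_polynomial_eq_sum (k : ℕ) (f : ℤ[X]) (hf : f.natDegree < 2 * k)
    (ho : ∀ i, f.coeff (2 * i) = 0) :
    f = ∑ l : Fin k, C (f.coeff (2 * l + 1)) * X ^ (2 * (l : ℕ) + 1) := by
  rw [Fin.sum_univ_eq_sum_range (fun l => C (f.coeff (2 * l + 1)) * X ^ (2 * l + 1))]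
  conv_lhs => rw [f.as_sum_range' _ hf]
  clear hf
  induction k with
  | zero => simp
  | succ k ih =>
    rw [Nat.mul_succ, Finset.sum_range_succ, Finset.sum_range_succ, ih, Finset.sum_range_succ, ho,
      C_mul_X_pow_eq_monomial, monomial_zero_right, add_zero]

theorem derivWronskian_hermite_eq (k m : ℕ) :
    wronskHe (fun i : Fin (k + 1) => if (i : ℕ) < k then 2 * (i : ℕ) + 1 else m)
      = derivWronskian (Fin.snoc (fun l : Fin k => X ^ (2 * (l : ℕ) + 1)) (hermite m) :
          Fin (k + 1) → ℤ[X]) := by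
  let U : Matrix (Fin (k + 1)) (Fin (k + 1)) ℤ := Matrix.of fun i j =>
    if (j : ℕ) < k then (hermite (2 * j + 1)).coeff (2 * i + 1) else if i = j then 1 else 0
  have hU : U.det = 1 := by
    rw [Matrix.det_of_isUpperTriangular]
    · refine Finset.prod_eq_one fun i _ => ?_
      simp only [U, Matrix.of_apply]
      split_ifs
      · exact coeff_hermite_self _
      · rfl
    · intro i j hij
      have hij' : (j : ℕ) < i := hij
      have : (j : ℕ) < k := by omega
      simp only [U, Matrix.of_apply, this, if_true]
      exact coeff_hermite_of_lt (by omega)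
  rw [wronskHe_eq, derivWronskian_change _
    (Fin.snoc (fun l : Fin k => X ^ (2 * (l : ℕ) + 1)) (hermite m) : Fin (k + 1) → ℤ[X]) U, hU]
  · simp
  · intro j
    rw [Fin.sum_univ_castSucc]
    simp only [Fin.snoc_castSucc, Fin.snoc_last]
    refine Fin.lastCases ?_ (fun j => ?_) j
    · simp [U, Fin.ext_iff, fun x : Fin k => x.2.ne]
    · have h : (hermite (2 * (j : ℕ) + 1)).coeff (2 * k + 1) = 0 :=
        coeff_hermite_of_lt (by omega)
      simp only [U, Matrix.of_apply, Fin.val_castSucc, j.2, if_true, Fin.val_last, h, C_0,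
        zero_mul, add_zero]
      refine odd_polynomial_eq_sum k _ (by rw [natDegree_hermite]; omega) fun i =>
        coeff_hermite_of_odd_add ?_
      exact ⟨j + i, by ring⟩

/-- The coefficient multiplier `∏_{j<k} (i - (2j+1))`. -/
def oddProd (k i : ℕ) : ℤ := ∏ j ∈ Finset.range k, ((i : ℤ) - (2 * j + 1))

/-- The image of `hermite m` under `∏_{j<k} (x d/dx - (2j+1))`. -/
noncomputable def core (m : ℕ) : ℕ → ℤ[X]
  | 0 => hermite m
  | k + 1 => X * derivative (core m k) - C (2 * (k : ℤ) + 1) * core m k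

theorem coeff_X_mul_derivative (p : ℤ[X]) (i : ℕ) :
    (X * derivative p).coeff i = i * p.coeff i := by
  cases i with
  | zero => simp
  | succ i => rw [coeff_X_mul, coeff_derivative]; push_cast; ring

theorem coeff_core (m k i : ℕ) : (core m k).coeff i = oddProd k i * (hermite m).coeff i := by
  induction k with
  | zero => simp [core, oddProd]
  | succ k ih =>
    rw [core, coeff_sub, coeff_C_mul, coeff_X_mul_derivative, ih, oddProd, oddProd,
      Finset.prod_range_succ]
    ring

theorem vand_odd (k : ℕ) : ∃ c : ℤ, c ≠ 0 ∧ ∀ m : ℕ,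
    vand (fun i : Fin (k + 1) => if (i : ℕ) < k then 2 * (i : ℕ) + 1 else m)
      = c * oddProd k m := by
  refine ⟨∏ j : Fin k, ∏ i ∈ Finset.Iio j.castSucc,
    ((2 * (j : ℕ) + 1 : ℤ) - (2 * (i : ℕ) + 1)), ?_, fun m => ?_⟩
  · refine Finset.prod_ne_zero_iff.2 fun j _ => Finset.prod_ne_zero_iff.2 fun i hi => ?_
    have : (i : ℕ) < j := by simpa [Fin.lt_def] using hi
    omega
  · rw [vand, Fin.prod_univ_castSucc, Fin.Iio_last_eq_map, Finset.prod_map, oddProd,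
      ← Fin.prod_univ_eq_prod_range (fun j => (m : ℤ) - (2 * j + 1))]
    congr 1
    · refine Finset.prod_congr rfl fun j _ => Finset.prod_congr rfl fun i hi => ?_
      have : (i : ℕ) < j := by simpa [Fin.lt_def] using hi
      have h : (i : ℕ) < k := by omega
      simp [h]
    · simp

theorem exists_wronskHe_eq_core (k : ℕ) : ∃ (c : ℤ) (a b : ℕ), c ≠ 0 ∧ ∀ m : ℕ,
    vand (fun i : Fin (k + 1) => if (i : ℕ) < k then 2 * (i : ℕ) + 1 else m)
      = c * oddProd k m ∧
    X ^ a * wronskHe (fun i : Fin (k + 1) => if (i : ℕ) < k then 2 * (i : ℕ) + 1 else m)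
      = C c * X ^ b * core m k := by
  obtain ⟨c, hc, hv⟩ := vand_odd k
  obtain ⟨A, hA⟩ := exists_derivWronskian_snoc (fun l : Fin k => (X : ℤ[X]) ^ (2 * (l : ℕ) + 1))
  have key : ∀ s : ℕ, X ^ (∑ i : Fin (k + 1), (i : ℕ)) * ∑ i, A i * derivative^[(i : ℕ)] (X ^ s)
      = C c * X ^ (∑ i : Fin k, (2 * (i : ℕ) + 1)) * (C (oddProd k s) * X ^ s) := by
    intro s
    have h := X_pow_mul_derivWronskian_X_pow
      (fun i : Fin (k + 1) => if (i : ℕ) < k then 2 * (i : ℕ) + 1 else s)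
    have e : (fun j : Fin (k + 1) => (X : ℤ[X]) ^ (if (j : ℕ) < k then 2 * (j : ℕ) + 1 else s))
        = (Fin.snoc (fun l : Fin k => (X : ℤ[X]) ^ (2 * (l : ℕ) + 1)) (X ^ s) :
          Fin (k + 1) → ℤ[X]) := by
      ext1 j
      refine Fin.lastCases ?_ (fun j => ?_) j <;> simp
    rw [Finset.prod_pow_eq_pow_sum, Finset.prod_pow_eq_pow_sum,
      Fin.sum_univ_castSucc (fun i : Fin (k + 1) => if (i : ℕ) < k then 2 * (i : ℕ) + 1 else s),
      e, hA, hv] at h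
    rw [h]
    simp [pow_add]
    ring
  refine ⟨c, ∑ i : Fin (k + 1), (i : ℕ), ∑ i : Fin k, (2 * (i : ℕ) + 1), hc, fun m => ⟨hv m, ?_⟩⟩
  rw [derivWronskian_hermite_eq, hA]
  have hH : hermite m = ∑ s ∈ Finset.range (m + 1), C ((hermite m).coeff s) * X ^ s := by
    conv_lhs => rw [(hermite m).as_sum_range_C_mul_X_pow, natDegree_hermite]
  have hF : core m k = ∑ s ∈ Finset.range (m + 1),
      C (oddProd k s * (hermite m).coeff s) * X ^ s := by
    ext i
    rw [coeff_core, finsetSum_coeff]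
    simp only [coeff_C_mul_X_pow]
    rw [Finset.sum_ite_eq]
    split_ifs with h
    · rfl
    · rw [coeff_hermite_of_lt (by simpa using h), mul_zero]
  rw [hF, hH]
  simp only [iterate_derivative_sum, iterate_derivative_C_mul, Finset.mul_sum]
  rw [Finset.sum_comm]
  refine Finset.sum_congr rfl fun s _ => ?_
  have := key s
  rw [Finset.mul_sum] at this
  calc _ = C ((hermite m).coeff s) * ∑ i : Fin (k + 1), X ^ (∑ i : Fin (k + 1), (i : ℕ)) *
        (A i * derivative^[(i : ℕ)] (X ^ s)) := by
        rw [Finset.mul_sum]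
        exact Finset.sum_congr rfl fun i _ => by ring
    _ = _ := by
        rw [this, ← hH, C_mul]
        ring

/-- If between any two points of a nonempty finite set there is a point satisfying `Z`, then
there are `#S - 1` such points strictly inside the range of `S`. -/
theorem exists_finset_between (Z : ℝ → Prop) (S : Finset ℝ) (hS : S.Nonempty)
    (h : ∀ a ∈ S, ∀ b ∈ S, a < b → ∃ c, a < c ∧ c < b ∧ Z c) :
    ∃ T : Finset ℝ, T.card + 1 = S.card ∧
      ∀ c ∈ T, Z c ∧ (∃ a ∈ S, a < c) ∧ ∃ b ∈ S, c < b := by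
  classical
  induction S using Finset.induction_on_max with
  | empty => simp at hS
  | insert x S hx ih =>
    have hxS : x ∉ S := fun hm => lt_irrefl x (hx x hm)
    rcases S.eq_empty_or_nonempty with rfl | hne
    · exact ⟨∅, by simp, by simp⟩
    · obtain ⟨T, hT, hT'⟩ := ih hne fun a ha b hb => h a (by simp [ha]) b (by simp [hb])
      have hmax := S.max'_mem hne
      obtain ⟨c, hc₁, hc₂, hc⟩ := h (S.max' hne) (by simp [hmax]) x (by simp) (hx _ hmax)
      have hcT : c ∉ T := by
        intro hm
        obtain ⟨-, -, b, hb, hcb⟩ := hT' c hm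
        exact absurd (S.le_max' b hb) (by linarith)
      refine ⟨insert c T, by rw [card_insert_of_notMem hcT, card_insert_of_notMem hxS, hT], ?_⟩
      intro d hd
      rcases Finset.mem_insert.1 hd with rfl | hd
      · exact ⟨hc, ⟨_, by simp [hmax], hc₁⟩, x, by simp, hc₂⟩
      · obtain ⟨hz, ⟨a, ha, hac⟩, b, hb, hcb⟩ := hT' d hd
        exact ⟨hz, ⟨a, by simp [ha], hac⟩, b, by simp [hb], hcb⟩

theorem exists_root_X_mul_derivative_sub (P : ℝ[X]) (s : ℕ) {a b : ℝ} (ha : 0 < a) (hab : a < b)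
    (hPa : P.eval a = 0) (hPb : P.eval b = 0) :
    ∃ c, a < c ∧ c < b ∧ (X * derivative P - C (s : ℝ) * P).eval c = 0 := by
  obtain ⟨c, ⟨h₁, h₂⟩, hc⟩ := exists_hasDerivAt_eq_zero (f := fun x => P.eval x / x ^ s)
    (f' := fun x => ((derivative P).eval x * x ^ s - P.eval x * (s * x ^ (s - 1))) / (x ^ s) ^ 2)
    hab
    (fun x hx => (P.continuousAt.div (continuous_pow s).continuousAt
      (pow_ne_zero _ (ha.trans_le hx.1).ne')).continuousWithinAt)
    (by simp [hPa, hPb])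
    (fun x hx => (P.hasDerivAt x).div (hasDerivAt_pow s x) (pow_ne_zero _ (ha.trans hx.1).ne'))
  have hc0 : 0 < c := ha.trans h₁
  refine ⟨c, h₁, h₂, ?_⟩
  have hp : (c ^ s) ^ 2 ≠ 0 := by positivity
  have hn := (div_eq_zero_iff.1 hc).resolve_right hp
  have : c ^ s * (c * (derivative P).eval c - s * P.eval c) = 0 := by
    rcases s with _ | s
    · simp at hn ⊢
      exact Or.inr hn
    · rw [Nat.add_sub_cancel] at hn
      linear_combination c * hn
  simpa [hc0.ne'] using this

theorem exists_root_X_mul_sub_derivative (P : ℝ[X]) {a b : ℝ} (hab : a < b)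
    (hPa : P.eval a = 0) (hPb : P.eval b = 0) :
    ∃ c, a < c ∧ c < b ∧ (X * P - derivative P).eval c = 0 := by
  obtain ⟨c, ⟨h₁, h₂⟩, hc⟩ := exists_hasDerivAt_eq_zero
    (f := fun x => P.eval x * Real.exp (-(x ^ 2 / 2)))
    (f' := fun x => (derivative P).eval x * Real.exp (-(x ^ 2 / 2))
      + P.eval x * (Real.exp (-(x ^ 2 / 2)) * -(((2 : ℕ) * x ^ (2 - 1)) / 2)))
    hab (by fun_prop) (by simp [hPa, hPb])
    (fun x _ => (P.hasDerivAt x).mul (((hasDerivAt_pow 2 x).div_const 2).neg.exp))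
  refine ⟨c, h₁, h₂, ?_⟩
  have : Real.exp (-(c ^ 2 / 2)) * (c * P.eval c - (derivative P).eval c) = 0 := by
    norm_num at hc
    linear_combination -hc
  simpa [(Real.exp_pos _).ne'] using this

/-- The Hermite polynomials over `ℝ`. -/
noncomputable def hermiteReal (n : ℕ) : ℝ[X] := (hermite n).map (Int.castRingHom ℝ)

theorem hermiteReal_succ (n : ℕ) :
    hermiteReal (n + 1) = X * hermiteReal n - derivative (hermiteReal n) := by
  simp [hermiteReal, hermite_succ, derivative_map]

theorem hermiteReal_monic (n : ℕ) : (hermiteReal n).Monic := (hermite_monic n).map _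

theorem natDegree_hermiteReal (n : ℕ) : (hermiteReal n).natDegree = n := by
  rw [hermiteReal, (hermite_monic n).natDegree_map, natDegree_hermite]

theorem coeff_hermite_zero_ne_zero {n : ℕ} (hn : Even n) : (hermite n).coeff 0 ≠ 0 := by
  obtain ⟨m, rfl⟩ := hn
  have h := coeff_hermite_explicit m 0
  rw [show 2 * m + 0 = m + m by ring] at h
  rw [h]
  simp [(Nat.doubleFactorial_pos _).ne']

theorem eval_zero_hermiteReal_of_even {n : ℕ} (hn : Even n) : (hermiteReal n).eval 0 ≠ 0 := by
  rw [← coeff_zero_eq_eval_zero, hermiteReal, coeff_map]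
  simpa using coeff_hermite_zero_ne_zero hn

theorem eval_zero_hermiteReal_of_odd {n : ℕ} (hn : Odd n) : (hermiteReal n).eval 0 = 0 := by
  rw [← coeff_zero_eq_eval_zero, hermiteReal, coeff_map, coeff_hermite_of_odd_add (by simpa)]
  simp

theorem Polynomial.Monic.exists_root_ge {P : ℝ[X]} (hP : P.Monic) (hd : 0 < P.natDegree) {r : ℝ}
    (hr : P.eval r ≤ 0) : ∃ x, r ≤ x ∧ P.eval x = 0 := by
  have ht := P.tendsto_atTop_of_leadingCoeff_nonneg (natDegree_pos_iff_degree_pos.1 hd)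
    (by rw [hP.leadingCoeff]; exact zero_le_one)
  obtain ⟨y, hy, hry⟩ := ((ht.eventually_ge_atTop 0).and (Filter.eventually_ge_atTop r)).exists
  obtain ⟨x, hx, hx0⟩ := intermediate_value_Icc hry P.continuous.continuousOn ⟨hr, hy⟩
  exact ⟨x, hx.1, hx0⟩

/-- Beyond its largest root `r`, a monic real polynomial is positive, so its derivative at `r` is
nonnegative. -/
theorem Polynomial.Monic.derivative_nonneg_of_largest_root {P : ℝ[X]} (hP : P.Monic)
    (hd : 0 < P.natDegree) {r : ℝ} (hr : P.eval r = 0) (hmax : ∀ x, P.eval x = 0 → x ≤ r) :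
    0 ≤ (derivative P).eval r := by
  by_contra! hneg
  have hlt : ∃ x, r < x ∧ P.eval x < 0 := by
    have h := (P.hasDerivAt r).tendsto_slope
    have h2 := (h.eventually (gt_mem_nhds hneg)).filter_mono
      (nhdsWithin_mono r (s := Set.Ioi r) (fun x (hx : r < x) => hx.ne'))
    obtain ⟨x, hx, hrx⟩ := (h2.and self_mem_nhdsWithin).exists
    have hrx : r < x := hrx
    refine ⟨x, hrx, ?_⟩
    rw [slope_def_field, hr, sub_zero, div_lt_iff₀ (by linarith)] at hx
    linarith
  obtain ⟨x, hrx, hx⟩ := hlt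
  obtain ⟨y, hxy, hy⟩ := hP.exists_root_ge hd hx.le
  linarith [hmax y hy]

theorem exists_nonneg_roots_hermiteReal (n : ℕ) :
    ∃ S : Finset ℝ, S.card = (n + 1) / 2 ∧ ∀ x ∈ S, 0 ≤ x ∧ (hermiteReal n).eval x = 0 := by
  classical
  induction n with
  | zero => exact ⟨∅, by simp, by simp⟩
  | succ n ih =>
    obtain ⟨S, hcard, hS⟩ := ih
    rcases n.eq_zero_or_pos with rfl | hn
    · refine ⟨{0}, by simp, fun x hx => ?_⟩
      rw [Finset.mem_singleton.1 hx]
      exact ⟨le_rfl, eval_zero_hermiteReal_of_odd (by simp)⟩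
    have hne : S.Nonempty := Finset.card_pos.1 (by omega)
    obtain ⟨T, hT, hT'⟩ := exists_finset_between
      (fun c => (hermiteReal (n + 1)).eval c = 0) S hne (fun a ha b hb hab => by
        rw [hermiteReal_succ]
        exact exists_root_X_mul_sub_derivative _ hab (hS a ha).2 (hS b hb).2)
    have hP0 : hermiteReal n ≠ 0 := (hermiteReal_monic n).ne_zero
    have hsub : S ⊆ (hermiteReal n).roots.toFinset := fun x hx => by
      simpa [hP0] using (hS x hx).2
    set R := (hermiteReal n).roots.toFinset with hR
    have hRne : R.Nonempty := hne.mono hsub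
    set r := R.max' hRne with hr
    have hr0 : (hermiteReal n).eval r = 0 := by
      simpa [hR, hP0] using R.max'_mem hRne
    have hrmax : ∀ x, (hermiteReal n).eval x = 0 → x ≤ r := fun x hx =>
      R.le_max' x (by simpa [hR, hP0] using hx)
    have hd := (hermiteReal_monic n).derivative_nonneg_of_largest_root
      (by rwa [natDegree_hermiteReal]) hr0 hrmax
    obtain ⟨y, hry, hy⟩ := (hermiteReal_monic (n + 1)).exists_root_ge
      (by rw [natDegree_hermiteReal]; omega) (r := r) (by
        rw [hermiteReal_succ]
        simp [hr0, hd])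
    have hyT : y ∉ T := by
      intro hm
      obtain ⟨-, -, b, hb, hyb⟩ := hT' y hm
      linarith [hrmax b (hS b hb).2]
    have hy0 : 0 ≤ y := by
      obtain ⟨a, ha⟩ := hne
      linarith [hrmax a (hS a ha).2, (hS a ha).1]
    have hTpos : ∀ c ∈ T, 0 < c := fun c hc => by
      obtain ⟨-, ⟨a, ha, hac⟩, -⟩ := hT' c hc
      linarith [(hS a ha).1]
    have hmem : ∀ x ∈ insert y T, 0 ≤ x ∧ (hermiteReal (n + 1)).eval x = 0 := by
      intro x hx
      rcases Finset.mem_insert.1 hx with rfl | hx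
      · exact ⟨hy0, hy⟩
      · exact ⟨(hTpos x hx).le, (hT' x hx).1⟩
    rcases n.even_or_odd with he | ho
    · have hSpos : ∀ a ∈ S, 0 < a := fun a ha => (hS a ha).1.lt_of_ne' fun h => by
        rw [h] at ha
        exact eval_zero_hermiteReal_of_even he (hS 0 ha).2
      have hypos : 0 < y := by
        obtain ⟨a, ha⟩ := hne
        linarith [hrmax a (hS a ha).2, hSpos a ha]
      have h0 : (0 : ℝ) ∉ insert y T := by
        intro h
        rcases Finset.mem_insert.1 h with h | h
        · exact hypos.ne h
        · exact lt_irrefl _ (hTpos 0 h)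
      refine ⟨insert 0 (insert y T), ?_, ?_⟩
      · rw [card_insert_of_notMem h0, card_insert_of_notMem hyT]
        obtain ⟨m, rfl⟩ := he
        omega
      · intro x hx
        rcases Finset.mem_insert.1 hx with rfl | hx
        · exact ⟨le_rfl, eval_zero_hermiteReal_of_odd he.add_one⟩
        · exact hmem x hx
    · refine ⟨insert y T, ?_, hmem⟩
      rw [card_insert_of_notMem hyT]
      obtain ⟨m, rfl⟩ := ho
      omega

theorem exists_pos_roots_hermiteReal (n : ℕ) :
    ∃ S : Finset ℝ, n / 2 ≤ S.card ∧ ∀ x ∈ S, 0 < x ∧ (hermiteReal n).eval x = 0 := by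
  classical
  obtain ⟨S, hcard, hS⟩ := exists_nonneg_roots_hermiteReal n
  rcases n.even_or_odd with he | ho
  · refine ⟨S, by omega, fun x hx => ⟨(hS x hx).1.lt_of_ne' fun h => ?_, (hS x hx).2⟩⟩
    subst h
    exact eval_zero_hermiteReal_of_even he (hS 0 hx).2
  · refine ⟨S.erase 0, ?_, fun x hx => ?_⟩
    · have := S.pred_card_le_card_erase (a := (0 : ℝ))
      obtain ⟨m, rfl⟩ := ho
      omega
    · obtain ⟨h0, hx⟩ := Finset.mem_erase.1 hx
      exact ⟨(hS x hx).1.lt_of_ne' h0, (hS x hx).2⟩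

/-- The Rolle theorem on (0, ∞), with one more zero when the two lowest coefficients of `P` have the
same sign. -/
theorem exists_pos_roots_derivative (P : ℝ[X]) (h0 : 0 < P.coeff 0 * P.coeff 1) (S : Finset ℝ)
    (hS : ∀ x ∈ S, 0 < x ∧ P.eval x = 0) :
    ∃ T : Finset ℝ, T.card = S.card ∧ ∀ x ∈ T, 0 < x ∧ (derivative P).eval x = 0 := by
  classical
  rcases S.eq_empty_or_nonempty with rfl | hne
  · exact ⟨∅, rfl, by simp⟩
  obtain ⟨T, hT, hT'⟩ := exists_finset_between (fun c => (derivative P).eval c = 0) S hne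
    (fun a ha b hb hab => by
      obtain ⟨c, ⟨h₁, h₂⟩, hc⟩ := exists_hasDerivAt_eq_zero hab P.continuous.continuousOn
        ((hS a ha).2.trans (hS b hb).2.symm) (fun x _ => P.hasDerivAt x)
      exact ⟨c, h₁, h₂, hc⟩)
  set r := S.min' hne with hr
  have hrS : r ∈ S := S.min'_mem hne
  obtain ⟨hr0, hPr⟩ := hS r hrS
  have e0 : P.eval 0 = P.coeff 0 := (coeff_zero_eq_eval_zero P).symm
  have e1 : (derivative P).eval 0 = P.coeff 1 := by
    rw [← coeff_zero_eq_eval_zero, coeff_derivative]; simp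
  obtain ⟨c, ⟨hc₁, hc₂⟩, hc⟩ := exists_hasDerivAt_eq_slope (fun x => P.eval x)
    (fun x => (derivative P).eval x) hr0 P.continuous.continuousOn (fun x _ => P.hasDerivAt x)
  simp only [hPr, e0, zero_sub, sub_zero] at hc
  have hneg : P.coeff 1 * (derivative P).eval c < 0 := by
    rw [hc, mul_div_assoc', div_neg_iff]
    exact Or.inr ⟨by linarith, hr0⟩
  have hroot : ∃ d, 0 < d ∧ d < r ∧ (derivative P).eval d = 0 := by
    have hcont : ContinuousOn (fun x => P.coeff 1 * (derivative P).eval x) (Set.Icc 0 c) := by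
      fun_prop
    have h1 : P.coeff 1 ≠ 0 := by
      intro h
      simp [h] at h0
    obtain ⟨d, hd, hd0⟩ := intermediate_value_Ioo' hc₁.le hcont
      (show (0 : ℝ) ∈ Set.Ioo _ _ from ⟨hneg, by
        simp only [e1]
        exact mul_self_pos.2 h1⟩)
    exact ⟨d, hd.1, hd.2.trans hc₂, by simpa [h1] using hd0⟩
  obtain ⟨d, hd0, hdr, hd⟩ := hroot
  have hTr : ∀ x ∈ T, r < x := fun x hx => by
    obtain ⟨-, ⟨a, ha, hax⟩, -⟩ := hT' x hx
    exact (S.min'_le a ha).trans_lt hax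
  refine ⟨insert d T, ?_, fun x hx => ?_⟩
  · rw [card_insert_of_notMem (fun h => (hdr.trans (hTr d h)).false), hT]
  · rcases Finset.mem_insert.1 hx with rfl | hx
    · exact ⟨hd0, hd⟩
    · exact ⟨hr0.trans (hTr x hx), (hT' x hx).1⟩

theorem card_pos_roots_le (Q : ℝ[X]) (hQ : Q ≠ 0) (k : ℕ)
    (hpos : ∀ j < k, 0 < Q.coeff j * Q.coeff (j + 1)) (hk : k ≤ Q.natDegree) (S : Finset ℝ)
    (hS : ∀ x ∈ S, 0 < x ∧ Q.eval x = 0) : S.card ≤ Q.natDegree - k := by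
  classical
  induction k generalizing Q S with
  | zero =>
    rw [Nat.sub_zero]
    refine (Finset.card_le_card (t := Q.roots.toFinset) fun x hx => ?_).trans
      ((Multiset.toFinset_card_le _).trans Q.card_roots')
    simpa [hQ] using (hS x hx).2
  | succ k ih =>
    obtain ⟨T, hT, hT'⟩ := exists_pos_roots_derivative Q (hpos 0 (by omega)) S hS
    have hdeg : (derivative Q).natDegree = Q.natDegree - 1 := natDegree_derivative Q
    rw [← hT]
    have := ih (derivative Q) (fun h => by
        have h1 := hpos 0 (by omega)
        have h2 : (derivative Q).coeff 0 = Q.coeff 1 := by rw [coeff_derivative]; simp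
        rw [h, coeff_zero] at h2
        simp [← h2] at h1)
      (fun j hj => by
        rw [coeff_derivative, coeff_derivative]
        have := hpos (j + 1) (by omega)
        have hj1 : (0 : ℝ) < (j : ℝ) + 1 := by positivity
        have hj2 : (0 : ℝ) < ((j + 1 : ℕ) : ℝ) + 1 := by positivity
        nlinarith [mul_pos (mul_pos hj1 hj2) this]) (by omega) T hT'
    omega

theorem oddProd_rec (k i : ℕ) :
    oddProd k (i + 2) * ((i : ℤ) + 1 - 2 * k) = oddProd k i * (i + 1) := by
  induction k with
  | zero => simp [oddProd]
  | succ k ih =>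
    rw [oddProd, oddProd, Finset.prod_range_succ, Finset.prod_range_succ, ← oddProd, ← oddProd]
    push_cast
    linear_combination ((i : ℤ) - (2 * k + 1)) * ih

theorem oddProd_ne_zero_of_even (k : ℕ) {i : ℕ} (hi : Even i) : oddProd k i ≠ 0 := by
  obtain ⟨l, rfl⟩ := hi
  refine Finset.prod_ne_zero_iff.2 fun j _ => ?_
  push_cast
  omega

theorem oddProd_ne_zero_of_le {k i : ℕ} (hi : 2 * k ≤ i) : oddProd k i ≠ 0 := by
  refine Finset.prod_ne_zero_iff.2 fun j hj => ?_
  have := Finset.mem_range.1 hj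
  omega

theorem oddProd_eq_zero {k i : ℕ} (ho : Odd i) (hi : i < 2 * k) : oddProd k i = 0 := by
  obtain ⟨l, rfl⟩ := ho
  exact Finset.prod_eq_zero (Finset.mem_range.2 (show l < k by omega)) (by push_cast; ring)

theorem derivative_derivative_hermite (m : ℕ) :
    derivative (derivative (hermite m)) = X * derivative (hermite m) - C (m : ℤ) * hermite m := by
  have h := derivative_hermite_succ m
  rw [hermite_succ, derivative_sub, derivative_mul, derivative_X, C_add, C_1] at h
  linear_combination -h

theorem coeff_hermite_rec (m i : ℕ) :
    (hermite m).coeff (i + 2) * (((i : ℤ) + 2) * (i + 1)) = ((i : ℤ) - m) * (hermite m).coeff i := by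
  have h := congrArg (fun p => coeff p i) (derivative_derivative_hermite m)
  simp only [coeff_derivative, coeff_sub, coeff_C_mul, coeff_X_mul_derivative] at h
  push_cast at h
  linear_combination h

theorem coeff_core_rec (m k i : ℕ) :
    (core m k).coeff (i + 2) * (((i : ℤ) + 2) * (i + 1 - 2 * k))
      = ((i : ℤ) - m) * (core m k).coeff i := by
  rw [coeff_core, coeff_core]
  linear_combination (hermite m).coeff (i + 2) * ((i : ℤ) + 2) * oddProd_rec k i
    + oddProd k i * coeff_hermite_rec m i

theorem coeff_core_of_odd_add {m k i : ℕ} (h : Odd (m + i)) : (core m k).coeff i = 0 := by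
  rw [coeff_core, coeff_hermite_of_odd_add h, mul_zero]

theorem core_ode {m k : ℕ} (hk : 1 ≤ k) :
    X * derivative (derivative (core m k)) + C (m : ℤ) * (X * core m k)
      = C (2 * k : ℤ) * derivative (core m k) + X * (X * derivative (core m k)) := by
  ext i
  cases i with
  | zero =>
    have : (core m k).coeff 1 = 0 := by
      rw [coeff_core, oddProd_eq_zero odd_one (by omega), zero_mul]
    simp [mul_coeff_zero, coeff_derivative, this]
  | succ i =>
    have h := coeff_core_rec m k i
    simp only [coeff_add, coeff_C_mul, coeff_X_mul, coeff_derivative, coeff_X_mul_derivative]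
    push_cast
    linear_combination h

theorem natDegree_core {m k : ℕ} (h : 2 * k ≤ m) : (core m k).natDegree = m := by
  refine natDegree_eq_of_le_of_coeff_ne_zero (natDegree_le_iff_coeff_eq_zero.2 fun i hi => ?_) ?_
  · rw [coeff_core, coeff_hermite_of_lt hi, mul_zero]
  · rw [coeff_core, coeff_hermite_self, mul_one]
    exact oddProd_ne_zero_of_le h

theorem core_ne_zero {m k : ℕ} (h : 2 * k ≤ m) : core m k ≠ 0 := by
  intro h0
  have h1 := coeff_core m k m
  rw [h0, coeff_hermite_self, coeff_zero, mul_one] at h1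
  exact oddProd_ne_zero_of_le h h1.symm

theorem core_comp_neg_X (m k : ℕ) : (core m k).comp (C (-1) * X) = C ((-1) ^ m) * core m k := by
  ext i
  rw [comp_C_mul_X_coeff, coeff_C_mul, mul_comm]
  rcases Nat.even_or_odd (m + i) with h | h
  · congr 1
    have : ((-1 : ℤ) ^ m) * (-1) ^ i = 1 := by rw [← pow_add, h.neg_one_pow]
    rcases neg_one_pow_eq_or ℤ m with h1 | h1 <;> rcases neg_one_pow_eq_or ℤ i with h2 | h2 <;>
      simp_all
  · simp [coeff_core_of_odd_add h]

theorem X_pow_dvd_core {m k : ℕ} (hm : Odd m) : X ^ (2 * k + 1) ∣ core m k := by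
  refine X_pow_dvd_iff.2 fun i hi => ?_
  rcases i.even_or_odd with h | h
  · exact coeff_core_of_odd_add (hm.add_even h)
  · rw [coeff_core, oddProd_eq_zero h ?_, zero_mul]
    obtain ⟨l, rfl⟩ := h
    omega

theorem coeff_zero_core_ne_zero {m k : ℕ} (hm : Even m) : (core m k).coeff 0 ≠ 0 := by
  rw [coeff_core]
  exact mul_ne_zero (oddProd_ne_zero_of_even k Even.zero) (coeff_hermite_zero_ne_zero hm)

theorem exists_pos_roots_core (m k : ℕ) :
    ∃ S : Finset ℝ, m / 2 ≤ S.card + k ∧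
      ∀ x ∈ S, 0 < x ∧ ((core m k).map (Int.castRingHom ℝ)).eval x = 0 := by
  induction k with
  | zero => exact exists_pos_roots_hermiteReal m
  | succ k ih =>
    obtain ⟨S, hcard, hS⟩ := ih
    rcases S.eq_empty_or_nonempty with rfl | hne
    · exact ⟨∅, by simp at hcard ⊢; omega, by simp⟩
    obtain ⟨T, hT, hT'⟩ := exists_finset_between
      (fun c => ((core m (k + 1)).map (Int.castRingHom ℝ)).eval c = 0) S hne
      (fun a ha b hb hab => by
        obtain ⟨c, h₁, h₂, hc⟩ := exists_root_X_mul_derivative_sub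
          ((core m k).map (Int.castRingHom ℝ)) (2 * k + 1) (hS a ha).1 hab (hS a ha).2 (hS b hb).2
        refine ⟨c, h₁, h₂, ?_⟩
        rw [← hc, core]
        simp [derivative_map])
    refine ⟨T, by omega, fun c hc => ?_⟩
    obtain ⟨h, ⟨a, ha, hac⟩, -⟩ := hT' c hc
    exact ⟨(hS a ha).1.trans hac, h⟩

theorem coeff_core_mul_pos {m k j : ℕ} (hm : Even m) (hkm : 2 * k ≤ m) (hj : j < k) :
    0 < (core m k).coeff (2 * j) * (core m k).coeff (2 * j + 2) := by
  have key : ∀ j < k, (core m k).coeff (2 * j) ≠ 0 →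
      0 < (core m k).coeff (2 * j) * (core m k).coeff (2 * j + 2) := by
    intro j hj h
    have hrec := coeff_core_rec m k (2 * j)
    push_cast at hrec
    have h1 : (0 : ℤ) < m - 2 * j := by omega
    have h2 : (0 : ℤ) < (2 * j + 2) * (2 * k - 2 * j - 1) :=
      mul_pos (by omega) (by omega)
    have h3 : 0 < (core m k).coeff (2 * j) * (core m k).coeff (2 * j) := mul_self_pos.2 h
    have h4 := mul_pos h1 h3
    have h5 : (core m k).coeff (2 * j) * (core m k).coeff (2 * j + 2) *
        ((2 * j + 2) * (2 * k - 2 * j - 1)) =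
        (m - 2 * j) * ((core m k).coeff (2 * j) * (core m k).coeff (2 * j)) := by
      linear_combination -(core m k).coeff (2 * j) * hrec
    exact pos_of_mul_pos_left (h5 ▸ h4) h2.le
  refine key j hj ?_
  induction j with
  | zero => exact coeff_zero_core_ne_zero hm
  | succ j ih =>
    have := key j (by omega) (ih (by omega))
    exact right_ne_zero_of_mul this.ne'

theorem card_pos_roots_core_le {m k : ℕ} (hm : Even m) (hkm : 2 * k ≤ m) (S : Finset ℝ)
    (hS : ∀ x ∈ S, 0 < x ∧ ((core m k).map (Int.castRingHom ℝ)).eval x = 0) :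
    S.card + k ≤ m / 2 := by
  classical
  set F := (core m k).map (Int.castRingHom ℝ) with hF
  set Q := contract 2 F with hQ
  have hFQ : expand ℝ 2 Q = F := by
    ext i
    rw [coeff_expand two_pos]
    split_ifs with h
    · rw [hQ, coeff_contract two_ne_zero, Nat.div_mul_cancel h]
    · rw [hF, coeff_map, coeff_core_of_odd_add, map_zero]
      exact hm.add_odd (Nat.not_even_iff_odd.1 fun he => h he.two_dvd)
  have hdeg : Q.natDegree * 2 = m := by
    rw [← natDegree_expand, hFQ, hF, natDegree_map_eq_of_injective Int.cast_injective,
      natDegree_core hkm]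
  have hQ0 : Q ≠ 0 := by
    intro h
    rw [h, map_zero] at hFQ
    exact (Polynomial.map_ne_zero_iff (f := Int.castRingHom ℝ) Int.cast_injective).2
      (core_ne_zero hkm) hFQ.symm
  have h := card_pos_roots_le Q hQ0 k (fun j hj => by
      have := coeff_core_mul_pos hm hkm hj
      rw [hQ, coeff_contract two_ne_zero, coeff_contract two_ne_zero, hF, coeff_map, coeff_map,
        mul_comm j 2, show (j + 1) * 2 = 2 * j + 2 by ring]
      simp only [eq_intCast]
      exact_mod_cast this)
    (by omega) (S.image fun x => x ^ 2) (fun y hy => by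
      obtain ⟨x, hx, rfl⟩ := Finset.mem_image.1 hy
      refine ⟨pow_pos (hS x hx).1 2, ?_⟩
      rw [← expand_eval, hFQ]
      exact (hS x hx).2)
  rw [Finset.card_image_of_injOn fun x hx y hy hxy =>
    (pow_left_inj₀ (hS x hx).1.le (hS y hy).1.le two_ne_zero).1 hxy] at h
  omega

/-- Nonzero roots of a polynomial solution of a second order linear equation with leading
coefficient `x` are simple. -/
theorem rootMultiplicity_eq_one_of_ode {P : ℂ[X]} (hP : P ≠ 0) (m a : ℂ)
    (h : X * derivative (derivative P) + C m * (X * P)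
      = C a * derivative P + X * (X * derivative P)) {z : ℂ} (hz : z ≠ 0) (hPz : P.eval z = 0) :
    rootMultiplicity z P = 1 := by
  obtain ⟨q, hq, hdvd⟩ := exists_eq_pow_rootMultiplicity_mul_and_not_dvd P hP z
  have hpos : 0 < rootMultiplicity z P := (rootMultiplicity_pos hP).2 hPz
  by_contra hne
  obtain ⟨s, hs⟩ : ∃ s, rootMultiplicity z P = s + 2 := ⟨rootMultiplicity z P - 2, by omega⟩
  rw [hs] at hq
  have hqz : q.eval z ≠ 0 := fun h0 => hdvd (dvd_iff_isRoot.2 h0)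
  have h1 : derivative P = (X - C z) ^ (s + 1) *
      (C ((s : ℂ) + 2) * q + (X - C z) * derivative q) := by
    rw [hq, derivative_mul, derivative_X_sub_C_pow, Nat.add_sub_assoc (by norm_num)]
    push_cast [C_add]
    simp only [map_natCast, map_ofNat]
    ring
  have h2 : derivative (derivative P) = (X - C z) ^ s *
      (C (((s : ℂ) + 1) * ((s : ℂ) + 2)) * q + (X - C z) * (C (2 * ((s : ℂ) + 2)) * derivative q
        + (X - C z) * derivative (derivative q))) := by
    rw [h1, derivative_mul, derivative_X_sub_C_pow, Nat.add_sub_cancel]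
    simp only [derivative_add, derivative_mul, derivative_sub, derivative_X, derivative_C]
    push_cast [C_add, C_mul]
    simp only [map_natCast, map_ofNat, map_one]
    ring
  have h3 : (X - C z) ^ s * (X * (C (((s : ℂ) + 1) * ((s : ℂ) + 2)) * q) - (X - C z) *
      ((C a + X * X) * (C ((s : ℂ) + 2) * q + (X - C z) * derivative q)
        - X * (C (2 * ((s : ℂ) + 2)) * derivative q + (X - C z) * derivative (derivative q))
        - C m * (X * ((X - C z) * q)))) = 0 := by
    rw [h2, h1] at h
    rw [hq] at h
    linear_combination h
  have h4 := (mul_eq_zero.1 h3).resolve_left (pow_ne_zero _ (X_sub_C_ne_zero z))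
  have h5 := congrArg (eval z) h4
  simp [hz, hqz] at h5
  rcases h5 with h5 | h5
  · exact Nat.cast_add_one_ne_zero s h5
  · have : ((s + 2 : ℕ) : ℂ) ≠ 0 := Nat.cast_ne_zero.2 (by omega)
    exact this (by push_cast; exact h5)

/-- The polynomial `core m k` over `ℂ`. -/
noncomputable def coreComplex (m k : ℕ) : ℂ[X] := (core m k).map (Int.castRingHom ℂ)

/-- The nonzero complex roots of `core m k`. -/
noncomputable def coreRoots (m k : ℕ) : Finset ℂ := (coreComplex m k).roots.toFinset.erase 0

theorem coreComplex_ne_zero {m k : ℕ} (h : 2 * k ≤ m) : coreComplex m k ≠ 0 :=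
  (Polynomial.map_ne_zero_iff (f := Int.castRingHom ℂ) Int.cast_injective).2 (core_ne_zero h)

theorem mem_coreRoots {m k : ℕ} (h : 2 * k ≤ m) {z : ℂ} :
    z ∈ coreRoots m k ↔ z ≠ 0 ∧ (coreComplex m k).eval z = 0 := by
  simp [coreRoots, coreComplex_ne_zero h]

theorem rootMultiplicity_coreComplex {m k : ℕ} (hk : 1 ≤ k) (h : 2 * k ≤ m) {z : ℂ}
    (hz : z ≠ 0) (hr : (coreComplex m k).eval z = 0) :
    rootMultiplicity z (coreComplex m k) = 1 := by
  refine rootMultiplicity_eq_one_of_ode (coreComplex_ne_zero h) m (2 * k) ?_ hz hr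
  have := congrArg (Polynomial.map (Int.castRingHom ℂ)) (core_ode (m := m) hk)
  simpa [coreComplex, derivative_map, show (C 2 : ℂ[X]) = 2 from rfl] using this

theorem rootMultiplicity_zero_add_card_coreRoots {m k : ℕ} (hk : 1 ≤ k) (h : 2 * k ≤ m) :
    rootMultiplicity 0 (coreComplex m k) + (coreRoots m k).card = m := by
  classical
  have hcard : (coreComplex m k).roots.card = m := by
    rw [IsAlgClosed.card_roots_eq_natDegree, coreComplex,
      natDegree_map_eq_of_injective Int.cast_injective, natDegree_core h]
  have hsum := Multiset.sum_count_eq_card (s := insert 0 (coreRoots m k))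
    (m := (coreComplex m k).roots) (fun a ha => by
      by_cases h0 : a = 0
      · simp [h0]
      · exact Finset.mem_insert_of_mem (Finset.mem_erase.2 ⟨h0, Multiset.mem_toFinset.2 ha⟩))
  rw [Finset.sum_insert (by simp [coreRoots]), hcard, count_roots] at hsum
  have hone : ∑ z ∈ coreRoots m k, (coreComplex m k).roots.count z = (coreRoots m k).card := by
    rw [Finset.card_eq_sum_ones]
    refine Finset.sum_congr rfl fun z hz => ?_
    obtain ⟨hz0, hz⟩ := (mem_coreRoots h).1 hz
    rw [count_roots, rootMultiplicity_coreComplex hk h hz0 hz]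
  rwa [hone] at hsum

theorem eval_neg_coreComplex {m k : ℕ} {z : ℂ} (hz : (coreComplex m k).eval z = 0) :
    (coreComplex m k).eval (-z) = 0 := by
  have h := congrArg (fun p => (p.map (Int.castRingHom ℂ)).eval z) (core_comp_neg_X m k)
  rw [coreComplex] at hz ⊢
  simpa [Polynomial.map_comp, hz] using h

theorem eval_ofReal_coreComplex (m k : ℕ) (x : ℝ) :
    (coreComplex m k).eval (x : ℂ) = 0 ↔ ((core m k).map (Int.castRingHom ℝ)).eval x = 0 := by
  have : coreComplex m k = ((core m k).map (Int.castRingHom ℝ)).map Complex.ofRealHom := by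
    rw [coreComplex, Polynomial.map_map]
    congr 1
  rw [this, ← Complex.ofRealHom_eq_coe, eval_map_apply]
  simp

/-- The real nonzero roots come in pairs `±x` with `x > 0`. -/
theorem exists_pos_roots_card_filter_coreRoots {m k : ℕ} (h : 2 * k ≤ m) :
    ∃ S : Finset ℝ, m / 2 ≤ S.card + k ∧
      (∀ x ∈ S, 0 < x ∧ ((core m k).map (Int.castRingHom ℝ)).eval x = 0) ∧
      ((coreRoots m k).filter fun z => z.im = 0).card = 2 * S.card := by
  classical
  set F := (core m k).map (Int.castRingHom ℝ) with hF
  have hF0 : F ≠ 0 :=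
    (Polynomial.map_ne_zero_iff (f := Int.castRingHom ℝ) Int.cast_injective).2 (core_ne_zero h)
  set S := F.roots.toFinset.filter fun x => 0 < x with hS
  have hmem : ∀ x, x ∈ S ↔ 0 < x ∧ F.eval x = 0 := fun x => by
    simp [hS, hF0, and_comm]
  obtain ⟨S₀, hcard, hS₀⟩ := exists_pos_roots_core m k
  refine ⟨S, hcard.trans (Nat.add_le_add_right (Finset.card_le_card fun x hx =>
    (hmem x).2 (hS₀ x hx)) k), fun x hx => (hmem x).1 hx, ?_⟩
  have himage : ((coreRoots m k).filter fun z => z.im = 0)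
      = S.image (fun x : ℝ => (x : ℂ)) ∪ S.image fun x : ℝ => -(x : ℂ) := by
    ext z
    simp only [Finset.mem_filter, mem_coreRoots h, Finset.mem_union, Finset.mem_image, hmem]
    constructor
    · rintro ⟨⟨hz0, hz⟩, him⟩
      obtain ⟨x, rfl⟩ : ∃ x : ℝ, z = x := ⟨z.re, Complex.ext rfl (by simpa using him)⟩
      have hx0 : x ≠ 0 := by simpa using hz0
      rcases hx0.lt_or_gt with hx | hx
      · refine Or.inr ⟨-x, ⟨by linarith, ?_⟩, by simp⟩
        rw [← eval_ofReal_coreComplex]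
        simpa using eval_neg_coreComplex hz
      · exact Or.inl ⟨x, ⟨hx, (eval_ofReal_coreComplex m k x).1 hz⟩, rfl⟩
    · rintro (⟨x, ⟨hx, hr⟩, rfl⟩ | ⟨x, ⟨hx, hr⟩, rfl⟩)
      · exact ⟨⟨by simpa using hx.ne', (eval_ofReal_coreComplex m k x).2 hr⟩, by simp⟩
      · exact ⟨⟨by simpa using hx.ne',
          eval_neg_coreComplex ((eval_ofReal_coreComplex m k x).2 hr)⟩, by simp⟩
  rw [himage, Finset.card_union_of_disjoint, Finset.card_image_of_injective,
    Finset.card_image_of_injective, two_mul]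
  · exact neg_injective.comp Complex.ofReal_injective
  · exact Complex.ofReal_injective
  · rw [Finset.disjoint_left]
    intro z hz₁ hz₂
    obtain ⟨x, hx, rfl⟩ := Finset.mem_image.1 hz₁
    obtain ⟨y, hy, hxy⟩ := Finset.mem_image.1 hz₂
    have : -y = x := by exact_mod_cast hxy
    linarith [((hmem x).1 hx).1, ((hmem y).1 hy).1]

theorem coreRoots_of_odd {m k : ℕ} (hk : 1 ≤ k) (h : 2 * k ≤ m) (hm : Odd m) :
    (∀ z ∈ coreRoots m k, z.im = 0) ∧ (coreRoots m k).card = m - 2 * k - 1 := by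
  classical
  have hmult : 2 * k + 1 ≤ rootMultiplicity 0 (coreComplex m k) := by
    rw [le_rootMultiplicity_iff (coreComplex_ne_zero h), C_0, sub_zero]
    have := Polynomial.map_dvd (Int.castRingHom ℂ) (X_pow_dvd_core (k := k) hm)
    rwa [Polynomial.map_pow, map_X] at this
  have hsum := rootMultiplicity_zero_add_card_coreRoots hk h
  obtain ⟨S, hS, -, hcard⟩ := exists_pos_roots_card_filter_coreRoots h
  have hle := Finset.card_filter_le (coreRoots m k) fun z => z.im = 0
  obtain ⟨l, rfl⟩ := hm
  have heq : (coreRoots (2 * l + 1) k).filter (fun z => z.im = 0) = coreRoots (2 * l + 1) k :=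
    Finset.eq_of_subset_of_card_le (Finset.filter_subset _ _) (by omega)
  exact ⟨Finset.filter_eq_self.1 heq, by omega⟩

theorem coreRoots_of_even {m k : ℕ} (hk : 1 ≤ k) (h : 2 * k ≤ m) (hm : Even m) :
    ((coreRoots m k).filter fun z => z.im = 0).card = m - 2 * k ∧
      ((coreRoots m k).filter fun z => z.im ≠ 0).card = 2 * k := by
  classical
  have hmult : rootMultiplicity 0 (coreComplex m k) = 0 := by
    refine rootMultiplicity_eq_zero ?_
    rw [IsRoot, ← coeff_zero_eq_eval_zero, coreComplex, coeff_map]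
    simpa using coeff_zero_core_ne_zero hm
  have hsum := rootMultiplicity_zero_add_card_coreRoots hk h
  obtain ⟨S, hS, hS', hcard⟩ := exists_pos_roots_card_filter_coreRoots h
  have hle := card_pos_roots_core_le hm h S hS'
  have hsplit := Finset.card_filter_add_card_filter_not (s := coreRoots m k) fun z => z.im = 0
  obtain ⟨l, rfl⟩ := hm
  constructor
  · omega
  · change (Finset.filter (fun z : ℂ => ¬ z.im = 0) _).card = _
    omega

theorem rootMultiplicity_C_mul_X_pow_mul {P : ℂ[X]} (hP : P ≠ 0) {c z : ℂ} (hc : c ≠ 0)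
    (hz : z ≠ 0) (b : ℕ) : rootMultiplicity z (C c * X ^ b * P) = rootMultiplicity z P := by
  have h0 : C c * X ^ b ≠ (0 : ℂ[X]) := mul_ne_zero (C_ne_zero.2 hc) (pow_ne_zero _ X_ne_zero)
  rw [rootMultiplicity_mul (mul_ne_zero h0 hP), rootMultiplicity_eq_zero, zero_add]
  simp [IsRoot, hc, hz]

/-- The Wronskian Hermite polynomial has the same nonzero roots, with the same multiplicities,
as `core m k`. -/
theorem rootMultiplicity_eq_coreComplex {m k : ℕ} (h : 2 * k ≤ m) (HeL : ℤ[X])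
    (hHe : C (vand (fun i : Fin (k + 1) => if (i : ℕ) < k then 2 * (i : ℕ) + 1 else m)) * HeL
      = wronskHe (fun i : Fin (k + 1) => if (i : ℕ) < k then 2 * (i : ℕ) + 1 else m)) :
    HeL ≠ 0 ∧ ∀ z : ℂ, z ≠ 0 → rootMultiplicity z (HeL.map (Int.castRingHom ℂ))
      = rootMultiplicity z (coreComplex m k) := by
  obtain ⟨c, a, b, hc, hw⟩ := exists_wronskHe_eq_core k
  obtain ⟨hv, hw⟩ := hw m
  rw [← hHe, hv] at hw
  have hv0 : c * oddProd k m ≠ 0 := mul_ne_zero hc (oddProd_ne_zero_of_le h)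
  have hne : HeL ≠ 0 := by
    rintro rfl
    rw [mul_zero, mul_zero] at hw
    exact mul_ne_zero (mul_ne_zero (C_ne_zero.2 hc) (pow_ne_zero _ X_ne_zero)) (core_ne_zero h)
      hw.symm
  refine ⟨hne, fun z hz => ?_⟩
  have hmap := congrArg (Polynomial.map (Int.castRingHom ℂ)) hw
  have hcore : (core m k).map (Int.castRingHom ℂ) = coreComplex m k := rfl
  simp only [Polynomial.map_mul, Polynomial.map_pow, map_X, map_C, hcore] at hmap
  rw [← mul_assoc, mul_comm (X ^ a)] at hmap
  have hcast : ∀ n : ℤ, n ≠ 0 → Int.castRingHom ℂ n ≠ 0 := fun n hn => by simpa using hn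
  rw [← rootMultiplicity_C_mul_X_pow_mul (coreComplex_ne_zero h) (hcast c hc) hz b, ← hmap,
    rootMultiplicity_C_mul_X_pow_mul _ (hcast _ hv0) hz a]
  exact (Polynomial.map_ne_zero_iff (f := Int.castRingHom ℂ) Int.cast_injective).2 hne

/-- Proposition `prop:staircase`, Veselov's conjecture for staircase
partitions.  Let `n ≥ k ≥ 1` and `λ = (n, k, k-1, …, 1)`, whose degree sequence is
`(1, 3, …, 2k-1, n+k)`.
(i) If `n - k` is odd, every non-zero complex root of `He_λ` is real and simple, and the
number of distinct non-zero roots is `n - k - 1`.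
(ii) If `n - k` is even, every non-zero complex root is simple, exactly `n - k` of the
non-zero roots are real and exactly `2k` of them are non-real. -/
theorem stmt7 (n k : ℕ) (hk : 1 ≤ k) (hkn : k ≤ n)
    (HeL : Polynomial ℤ)
    (hHe : Polynomial.C
        (vand (fun i : Fin (k + 1) => if (i : ℕ) < k then 2 * (i : ℕ) + 1 else n + k)) * HeL
      = wronskHe (fun i : Fin (k + 1) => if (i : ℕ) < k then 2 * (i : ℕ) + 1 else n + k)) :
    (Odd (n - k) →
      (∀ z : ℂ, z ≠ 0 → Polynomial.aeval z HeL = 0 →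
        z.im = 0 ∧ Polynomial.rootMultiplicity z (HeL.map (Int.castRingHom ℂ)) = 1) ∧
      {z : ℂ | z ≠ 0 ∧ Polynomial.aeval z HeL = 0}.ncard = n - k - 1) ∧
    (Even (n - k) →
      (∀ z : ℂ, z ≠ 0 → Polynomial.aeval z HeL = 0 →
        Polynomial.rootMultiplicity z (HeL.map (Int.castRingHom ℂ)) = 1) ∧
      {z : ℂ | z ≠ 0 ∧ Polynomial.aeval z HeL = 0 ∧ z.im = 0}.ncard = n - k ∧
      {z : ℂ | z ≠ 0 ∧ Polynomial.aeval z HeL = 0 ∧ z.im ≠ 0}.ncard = 2 * k) := by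
  have hm : 2 * k ≤ n + k := by omega
  obtain ⟨hne, hmult⟩ := rootMultiplicity_eq_coreComplex hm HeL hHe
  have hroot : ∀ z : ℂ, z ≠ 0 → (aeval z HeL = 0 ↔ (coreComplex (n + k) k).eval z = 0) := by
    intro z hz
    have hne' : HeL.map (Int.castRingHom ℂ) ≠ 0 :=
      (Polynomial.map_ne_zero_iff (f := Int.castRingHom ℂ) Int.cast_injective).2 hne
    rw [aeval_def, eval₂_eq_eval_map, algebraMap_int_eq, ← IsRoot, ← IsRoot,
      ← rootMultiplicity_pos hne', hmult z hz, rootMultiplicity_pos (coreComplex_ne_zero hm)]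
  have hmem : ∀ z : ℂ, z ∈ coreRoots (n + k) k ↔ z ≠ 0 ∧ aeval z HeL = 0 := fun z => by
    rw [mem_coreRoots hm]
    exact and_congr_right fun hz => (hroot z hz).symm
  have hsimple : ∀ z : ℂ, z ≠ 0 → aeval z HeL = 0 →
      rootMultiplicity z (HeL.map (Int.castRingHom ℂ)) = 1 := fun z hz h => by
    rw [hmult z hz]
    exact rootMultiplicity_coreComplex hk hm hz ((hroot z hz).1 h)
  constructor
  · intro ho
    have ho' : Odd (n + k) := by
      obtain ⟨l, hl⟩ := ho
      exact ⟨l + k, by omega⟩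
    obtain ⟨hreal, hcard⟩ := coreRoots_of_odd hk hm ho'
    refine ⟨fun z hz h => ⟨hreal z ((hmem z).2 ⟨hz, h⟩), hsimple z hz h⟩, ?_⟩
    have : {z : ℂ | z ≠ 0 ∧ aeval z HeL = 0} = (coreRoots (n + k) k : Set ℂ) := by
      ext z
      simpa using (hmem z).symm
    rw [this, Set.ncard_coe_finset, hcard]
    omega
  · intro he
    have he' : Even (n + k) := by
      obtain ⟨l, hl⟩ := he
      exact ⟨l + k, by omega⟩
    obtain ⟨hreal, hnonreal⟩ := coreRoots_of_even hk hm he'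
    refine ⟨hsimple, ?_, ?_⟩
    · have : {z : ℂ | z ≠ 0 ∧ aeval z HeL = 0 ∧ z.im = 0}
          = ((coreRoots (n + k) k).filter fun z => z.im = 0 : Finset ℂ) := by
        ext z
        rw [Finset.mem_coe, Finset.mem_filter, hmem, and_assoc]
        rfl
      rw [this, Set.ncard_coe_finset, hreal]
      omega
    · have : {z : ℂ | z ≠ 0 ∧ aeval z HeL = 0 ∧ z.im ≠ 0}
          = ((coreRoots (n + k) k).filter fun z => z.im ≠ 0 : Finset ℂ) := by
        ext z
        rw [Finset.mem_coe, Finset.mem_filter, hmem, and_assoc]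
        rfl
      rw [this, Set.ncard_coe_finset, hnonreal]
end

section
/- Suppose m ≥ 1 and p ≥ 2m − 1 is a prime. Let 0 ≤ k ≤ ⌊(m+1)/2⌋ + 1 and let n < N_k. Then for every partition λ of n whose 2-core has size m(m+1)/2 (that is, m_λ = m), we have ν_p(F_λ) ≥ ν_p(n!) − (k − 1). -/
open Polynomial Finset

/-- The numbers `N_k`: `N_k = kp - k(2(m-k)+1) + m(m+1)/2` for `0 ≤ k ≤ ⌊(m+1)/2⌋`,
and `N_{⌊(m+1)/2⌋+1} = (⌊(m+1)/2⌋+1)·p`. -/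
def Nval (m p k : ℕ) : ℤ :=
  if k ≤ (m + 1) / 2 then
    (k : ℤ) * p - k * (2 * ((m : ℤ) - k) + 1) + m * (m + 1) / 2
  else (((m + 1) / 2 : ℕ) + 1 : ℤ) * p

/-- The character degree `F_λ = n!·Δ(n_λ)/(n_1!⋯n_r!)` as a rational number. -/
noncomputable def Fdeg {r : ℕ} (n : ℕ) (ns : Fin r → ℕ) : ℚ :=
  ((Nat.factorial n : ℕ) : ℚ) * (vand ns : ℚ) / ∏ i : Fin r, ((Nat.factorial (ns i) : ℕ) : ℚ)

theorem card_filter_lt_symm {ι : Type*} [Fintype ι] [DecidableEq ι] (g : ι → ℕ)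
    (hg : Function.Injective g) (R : ι → ι → Prop) [DecidableRel R]
    (hR : ∀ i j, R i j → R j i) :
    2 * ∑ j, #{i | g i < g j ∧ R i j} = ∑ j, #{i | i ≠ j ∧ R i j} := by
  have h1 : ∑ j, #{i | g i < g j ∧ R i j} = ∑ j, #{i | g j < g i ∧ R i j} := by
    simp only [card_filter]
    rw [sum_comm]
    refine sum_congr rfl fun i _ => sum_congr rfl fun j _ => ?_
    have : R i j ↔ R j i := ⟨hR i j, hR j i⟩
    simp [this]
  rw [two_mul]
  nth_rewrite 2 [h1]
  rw [← sum_add_distrib]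
  refine sum_congr rfl fun j _ => ?_
  rw [← card_union_of_disjoint]
  · congr 1
    ext i
    have : i ≠ j ↔ g i < g j ∨ g j < g i := by
      rw [← hg.ne_iff]; omega
    simp only [mem_union, mem_filter, mem_univ, true_and, this]
    tauto
  · rw [disjoint_filter]
    intro i _ h h'
    omega

/-- The number of pairs `i < j` whose values are congruent modulo `p`. -/
def congrPairs {r : ℕ} (p : ℕ) (f : Fin r → ℕ) : ℕ :=
  ∑ j : Fin r, #{i | i < j ∧ f i ≡ f j [MOD p]}

theorem congrPairs_eq_of_injective {r p : ℕ} {f : Fin r → ℕ} (hf : Function.Injective f) :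
    congrPairs p f = ∑ j : Fin r, #{i | f i < f j ∧ f i ≡ f j [MOD p]} := by
  have h1 := card_filter_lt_symm f hf (fun i j => f i ≡ f j [MOD p]) fun _ _ h => h.symm
  have h2 := card_filter_lt_symm (fun i : Fin r => (i : ℕ)) Fin.val_injective
    (fun i j => f i ≡ f j [MOD p]) fun _ _ h => h.symm
  simp only [Fin.val_fin_lt] at h2
  unfold congrPairs
  omega

theorem exists_sub_notMem_range {r p : ℕ} (hp : 0 < p) {f : Fin r → ℕ}
    (hf : Function.Injective f) (h : congrPairs p f < ∑ i, f i / p) :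
    ∃ i, p ≤ f i ∧ ∀ j, f j ≠ f i - p := by
  by_contra! hno
  refine absurd h (not_lt.2 ?_)
  rw [congrPairs_eq_of_injective hf]
  refine sum_le_sum fun j _ => ?_
  have key : ∀ t, t * p ≤ f j → ∃ i, f i = f j - t * p := by
    intro t
    induction t with
    | zero => intro _; exact ⟨j, by simp⟩
    | succ t ih =>
      intro ht
      rw [add_mul, one_mul] at ht
      obtain ⟨i, hi⟩ := ih (by omega)
      obtain ⟨i', hi'⟩ := hno i (by omega)
      exact ⟨i', by rw [hi', hi, add_mul, one_mul]; omega⟩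
  have hsub : (Finset.Icc 1 (f j / p)).image (fun t => f j - t * p) ⊆
      (Finset.univ.filter fun i => f i < f j ∧ f i ≡ f j [MOD p]).image f := by
    intro z hz
    simp only [mem_image, Finset.mem_Icc, mem_filter, mem_univ, true_and] at hz ⊢
    obtain ⟨t, ⟨ht1, ht2⟩, rfl⟩ := hz
    have htp : t * p ≤ f j := (Nat.le_div_iff_mul_le hp).1 ht2
    have hpos : 0 < t * p := Nat.mul_pos ht1 hp
    obtain ⟨i, hi⟩ := key t htp
    refine ⟨i, ⟨by omega, ?_⟩, hi⟩
    refine (Nat.modEq_iff_dvd' (by omega)).2 ⟨t, ?_⟩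
    rw [mul_comm]; omega
  have hcard : #((Finset.Icc 1 (f j / p)).image (fun t => f j - t * p)) = f j / p := by
    rw [card_image_of_injOn, Nat.card_Icc, Nat.add_sub_cancel]
    intro s hs t ht hst
    simp only [Finset.coe_Icc, Set.mem_Icc] at hs ht
    have h1 : s * p ≤ f j := (Nat.le_div_iff_mul_le hp).1 hs.2
    have h2 : t * p ≤ f j := (Nat.le_div_iff_mul_le hp).1 ht.2
    have h3 : f j - s * p = f j - t * p := hst
    exact Nat.eq_of_mul_eq_mul_right hp (by omega)
  calc f j / p = _ := hcard.symm
    _ ≤ _ := card_le_card hsub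
    _ ≤ _ := card_image_le

theorem dStat_eq_sum {r : ℕ} (f : Fin r → ℕ) :
    dStat f = ∑ i, (if Odd (f i) then (1 : ℤ) else -1) := by
  unfold dStat
  rw [card_filter, card_filter]
  push_cast
  rw [← sum_sub_distrib]
  refine sum_congr rfl fun i _ => ?_
  rcases Nat.even_or_odd (f i) with h | h
  · simp [h, Nat.not_odd_iff_even.2 h]
  · simp [h, Nat.not_even_iff_odd.2 h]

theorem sum_comp_update {ι M : Type*} [Fintype ι] [DecidableEq ι] [AddCommGroup M] (g : ℕ → M)
    (f : ι → ℕ) (i : ι) (x : ℕ) :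
    ∑ j, g (Function.update f i x j) = ∑ j, g (f j) - g (f i) + g x := by
  rw [← add_sum_erase univ _ (mem_univ i), ← add_sum_erase univ (fun j => g (f j)) (mem_univ i),
    Function.update_self,
    sum_congr rfl fun j hj => by rw [Function.update_of_ne (ne_of_mem_erase hj)]]
  abel

theorem abs_dStat_update_sub_le {r : ℕ} (f : Fin r → ℕ) (i : Fin r) (x : ℕ) :
    |dStat (Function.update f i x) - dStat f| ≤ 2 := by
  rw [dStat_eq_sum, dStat_eq_sum, sum_comp_update (fun y => if Odd y then (1 : ℤ) else -1), abs_le]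
  split_ifs <;> constructor <;> linarith

theorem update_injective_of_ne {ι : Type*} [DecidableEq ι] {f : ι → ℕ}
    (hf : Function.Injective f) (i : ι) {x : ℕ} (hx : ∀ j, f j ≠ x) :
    Function.Injective (Function.update f i x) := by
  intro a b hab
  by_cases ha : a = i <;> by_cases hb : b = i
  · rw [ha, hb]
  · subst ha; simp [Function.update_of_ne hb] at hab; exact absurd hab.symm (hx b)
  · subst hb; simp [Function.update_of_ne ha] at hab; exact absurd hab (hx a)
  · rw [Function.update_of_ne ha, Function.update_of_ne hb] at hab; exact hf hab

/-- Removing `k` rim hooks of length `p`, in terms of degree sequences. -/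
theorem exists_remove_hooks {r p : ℕ} (hp : 0 < p) (k : ℕ) :
    ∀ f : Fin r → ℕ, Function.Injective f → congrPairs p f + k ≤ ∑ i, f i / p →
    ∃ g : Fin r → ℕ, Function.Injective g ∧ ∑ i, (g i : ℤ) + k * p = ∑ i, (f i : ℤ) ∧
      |dStat g - dStat f| ≤ 2 * k := by
  induction k with
  | zero => intro f hf _; exact ⟨f, hf, by simp, by simp⟩
  | succ k ih =>
    intro f hf h
    obtain ⟨i, hi, hne⟩ := exists_sub_notMem_range hp hf (by omega)
    have hQ : congrPairs p (Function.update f i (f i - p)) = congrPairs p f := by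
      have hmod : ∀ j, Function.update f i (f i - p) j % p = f j % p := by
        intro j
        by_cases hj : j = i
        · subst hj
          rw [Function.update_self, ← Nat.mod_eq_sub_mod hi]
        · rw [Function.update_of_ne hj]
      refine sum_congr rfl fun j _ => congrArg card (filter_congr fun a _ => ?_)
      simp only [Nat.ModEq, hmod]
    have hdiv := sum_comp_update (fun y => ((y / p : ℕ) : ℤ)) f i (f i - p)
    have hsum := sum_comp_update (fun y => (y : ℤ)) f i (f i - p)
    have hq : f i / p = (f i - p) / p + 1 := by
      rw [Nat.div_eq_sub_div hp hi]
    obtain ⟨g, hg, hgs, hgd⟩ := ih _ (update_injective_of_ne hf i hne) (by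
      rw [hQ]
      zify at h ⊢
      simp only [Int.natCast_ediv] at hdiv ⊢ h
      have hq' : (f i : ℤ) / p = ((f i - p : ℕ) : ℤ) / p + 1 := by exact_mod_cast hq
      linarith)
    refine ⟨g, hg, ?_, ?_⟩
    · push_cast [hi] at hsum ⊢
      linarith
    · have := abs_dStat_update_sub_le f i (f i - p)
      push_cast
      rw [abs_le] at *
      constructor <;> linarith [this.1, this.2, hgd.1, hgd.2]

theorem card_mul_card_sub_one_le_sum {ι : Type*} (s : Finset ι) (g : ι → ℕ)
    (hg : Set.InjOn g s) : (#s : ℤ) * (#s - 1) ≤ 2 * ∑ i ∈ s, (g i : ℤ) := by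
  have hinj : Set.InjOn (fun i => (g i : ℤ)) s := fun i hi j hj h => hg hi hj (Int.ofNat.inj h)
  have h1 := sum_range_le_sum (s := s.image fun i => (g i : ℤ)) (c := 0) (by simp)
  rw [card_image_of_injOn hinj, sum_image hinj] at h1
  simp only [zero_add] at h1
  have h2 : (∑ i ∈ range #s, (i : ℤ)) * 2 = ((#s * (#s - 1) : ℕ) : ℤ) := by
    rw [← sum_range_id_mul_two]
    push_cast
    rfl
  have h3 : ((#s * (#s - 1) : ℕ) : ℤ) = (#s : ℤ) * (#s - 1) := by
    cases #s <;> simp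
  linarith

/-- A partition is at least as large as its 2-core. -/
theorem card_add_dStat_le_sum {r : ℕ} {f : Fin r → ℕ} (hf : Function.Injective f) :
    (r : ℤ) * (r - 1) + dStat f * (dStat f + 1) ≤ 2 * ∑ i, (f i : ℤ) := by
  set A := univ.filter fun i => Odd (f i) with hA
  set B := univ.filter fun i => Even (f i) with hB
  have hBA : B = univ.filter fun i => ¬ Odd (f i) := by simp [hB]
  have hcard : (r : ℤ) = #A + #B := by
    have := card_filter_add_card_filter_not (s := (univ : Finset (Fin r))) (fun i => Odd (f i))
    rw [card_univ, Fintype.card_fin, ← hBA] at this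
    exact_mod_cast this.symm
  have hd : dStat f = #A - #B := rfl
  have hs : ∑ i, (f i : ℤ) = ∑ i ∈ A, (f i : ℤ) + ∑ i ∈ B, (f i : ℤ) := by
    rw [hBA]; exact (sum_filter_add_sum_filter_not _ _ _).symm
  have h1 := card_mul_card_sub_one_le_sum A (fun i => f i / 2) (by
    intro i hi j hj hij
    simp only [hA, coe_filter, mem_univ, true_and, Set.mem_ofPred_eq, Nat.odd_iff] at hi hj
    exact hf (by dsimp at hij; omega))
  have h2 := card_mul_card_sub_one_le_sum B (fun i => f i / 2) (by
    intro i hi j hj hij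
    simp only [hB, coe_filter, mem_univ, true_and, Set.mem_ofPred_eq, Nat.even_iff] at hi hj
    exact hf (by dsimp at hij; omega))
  have h3 : ∑ i ∈ A, (f i : ℤ) = 2 * ∑ i ∈ A, ((f i / 2 : ℕ) : ℤ) + #A := by
    rw [mul_sum, card_eq_sum_ones, Nat.cast_sum, ← sum_add_distrib]
    refine sum_congr rfl fun i hi => ?_
    simp only [hA, mem_filter, mem_univ, true_and, Nat.odd_iff] at hi
    omega
  have h4 : ∑ i ∈ B, (f i : ℤ) = 2 * ∑ i ∈ B, ((f i / 2 : ℕ) : ℤ) := by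
    rw [mul_sum]
    refine sum_congr rfl fun i hi => ?_
    simp only [hB, mem_filter, mem_univ, true_and, Nat.even_iff] at hi
    omega
  rw [hd, hcard, hs, h3, h4]
  nlinarith

theorem padicValNat_prod {ι : Type*} {p : ℕ} [Fact p.Prime] (s : Finset ι) (g : ι → ℕ)
    (hg : ∀ i ∈ s, g i ≠ 0) :
    padicValNat p (∏ i ∈ s, g i) = ∑ i ∈ s, padicValNat p (g i) := by
  classical
  induction s using Finset.induction_on with
  | empty => simp
  | insert a s ha ih =>
    have hs : ∀ i ∈ s, g i ≠ 0 := fun i hi => hg i (mem_insert_of_mem hi)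
    rw [prod_insert ha, sum_insert ha,
      padicValNat.mul (hg a (mem_insert_self a s)) (prod_ne_zero_iff.2 hs), ih hs]

theorem padicValNat_factorial_eq_sum {p : ℕ} [Fact p.Prime] (x : ℕ) :
    padicValNat p x.factorial = ∑ z ∈ range x, padicValNat p (x - z) := by
  have : ∏ z ∈ range x, (x - z) = x.factorial := by
    rw [← prod_range_add_one_eq_factorial, ← prod_range_reflect]
    refine prod_congr rfl fun z hz => ?_
    have := mem_range.1 hz
    omega
  rw [← this]
  exact padicValNat_prod _ _ fun z hz => by have := mem_range.1 hz; omega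

theorem card_filter_dvd_sub {p : ℕ} (x : ℕ) :
    #{z ∈ range x | p ∣ x - z} = x / p := by
  rw [← Nat.card_multiples x p]
  refine card_bij (fun z _ => x - z - 1) ?_ ?_ ?_
  · intro z hz
    simp only [mem_filter, mem_range] at hz ⊢
    refine ⟨by omega, ?_⟩
    rw [Nat.sub_add_cancel (by omega)]
    exact hz.2
  · intro a ha b hb h
    simp only [mem_filter, mem_range] at ha hb
    omega
  · intro b hb
    simp only [mem_filter, mem_range] at hb
    refine ⟨x - 1 - b, ?_, by omega⟩
    simp only [mem_filter, mem_range]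
    refine ⟨by omega, ?_⟩
    rw [show x - (x - 1 - b) = b + 1 by omega]
    exact hb.2

theorem padicValRat_vand {r p : ℕ} [Fact p.Prime] {f : Fin r → ℕ} (hf : StrictMono f) :
    padicValRat p (vand f : ℚ) = ∑ j, ∑ i ∈ Iio j, (padicValNat p (f j - f i) : ℤ) := by
  have h : (vand f : ℚ) = ((∏ j, ∏ i ∈ Iio j, (f j - f i) : ℕ) : ℚ) := by
    unfold vand
    push_cast
    refine prod_congr rfl fun j _ => prod_congr rfl fun i hi => ?_
    rw [Nat.cast_sub (hf (mem_Iio.1 hi)).le]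
  have hne : ∀ j : Fin r, ∀ i ∈ Iio j, f j - f i ≠ 0 := fun j i hi => by
    have := hf (mem_Iio.1 hi); omega
  rw [h, padicValRat.of_nat, padicValNat_prod _ _ fun j _ => prod_ne_zero_iff.2 (hne j),
    Nat.cast_sum]
  refine sum_congr rfl fun j _ => ?_
  rw [padicValNat_prod _ _ (hne j), Nat.cast_sum]

/-- The hook lengths of a partition of size less than `p ^ 2` contribute at most one factor `p`
each, so that the valuation of their product is at most the `p`-weight. -/
theorem sum_padicValNat_factorial_le {r p : ℕ} [hp : Fact p.Prime] {f : Fin r → ℕ}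
    (hf : StrictMono f) (hlt : ∑ i, 2 * (f i : ℤ) < r * (r - 1) + 2 * p ^ 2) :
    ∑ j, (padicValNat p (f j).factorial : ℤ) + congrPairs p f ≤
      ∑ j, ∑ i ∈ Iio j, (padicValNat p (f j - f i) : ℤ) + ∑ j, ((f j / p : ℕ) : ℤ) := by
  unfold congrPairs
  rw [Nat.cast_sum, ← sum_add_distrib, ← sum_add_distrib]
  refine sum_le_sum fun j _ => ?_
  norm_cast
  set I := (Iio j).image f with hI
  have hIsub : I ⊆ range (f j) := by
    intro z hz
    obtain ⟨i, hi, rfl⟩ := mem_image.1 hz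
    exact mem_range.2 (hf (mem_Iio.1 hi))
  have hsum : ∑ i ∈ Iio j, padicValNat p (f j - f i) = ∑ z ∈ I, padicValNat p (f j - z) := by
    rw [hI, sum_image hf.injective.injOn]
  have hcardI : #{i | i < j ∧ f i ≡ f j [MOD p]} = #{z ∈ I | p ∣ f j - z} := by
    rw [hI, filter_image, card_image_of_injective _ hf.injective]
    congr 1
    ext i
    simp only [mem_filter, mem_univ, true_and, mem_Iio]
    refine and_congr_right fun h => ?_
    exact Nat.modEq_iff_dvd' (hf h).le
  rw [padicValNat_factorial_eq_sum, ← sum_sdiff hIsub, hsum, hcardI, ← card_filter_dvd_sub (p := p)]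
  have hsplit : #{z ∈ range (f j) | p ∣ f j - z} =
      #{z ∈ range (f j) \ I | p ∣ f j - z} + #{z ∈ I | p ∣ f j - z} := by
    simp only [card_filter]
    rw [sum_sdiff hIsub]
  have hbound : ∑ z ∈ range (f j) \ I, padicValNat p (f j - z) ≤
      #{z ∈ range (f j) \ I | p ∣ f j - z} := by
    rw [card_filter]
    refine sum_le_sum fun z hz => ?_
    rw [mem_sdiff, mem_range] at hz
    have hzr : ∀ i, f i ≠ z := fun i hi => hz.2 (mem_image.2 ⟨i, mem_Iio.2
      (hf.lt_iff_lt.1 (hi ▸ hz.1)), hi⟩)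
    have hsmall : f j - z < p ^ 2 := by
      have h1 := card_add_dStat_le_sum (update_injective_of_ne hf.injective j hzr)
      have h2 := sum_comp_update (fun y => (y : ℤ)) f j z
      have h3 : ∀ d : ℤ, 0 ≤ d * (d + 1) := fun d => by
        rcases le_or_gt 0 d with h | h <;> nlinarith
      have h4 := h3 (dStat (Function.update f j z))
      rw [← mul_sum] at hlt
      zify [hz.1.le]
      linarith
    split_ifs with hdvd
    · by_contra! hgt
      have h1 := (padicValNat_dvd_iff_le (p := p) (n := 2) (a := f j - z) (by omega)).2 hgt
      exact absurd (Nat.le_of_dvd (by omega) h1) (by omega)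
    · exact (padicValNat.eq_zero_of_not_dvd hdvd).le
  omega

theorem two_mul_Nval_of_le {m p k : ℕ} (hk : k ≤ (m + 1) / 2) :
    2 * Nval m p k = 2 * (k * p) + (m - 2 * k) * (m - 2 * k + 1) := by
  have h : 2 * ((m : ℤ) * (m + 1) / 2) = m * (m + 1) :=
    Int.mul_ediv_cancel' (Int.even_mul_succ_self _).two_dvd
  rw [Nval, if_pos hk]
  linear_combination h

theorem Nval_of_lt {m p k : ℕ} (hk : k = (m + 1) / 2 + 1) : Nval m p k = k * p := by
  rw [Nval, if_neg (by omega), hk]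
  push_cast
  ring

theorem Nval_le_sq {m p k : ℕ} (hm : 1 ≤ m) (hp : 2 ≤ p) (hpm : 2 * m - 1 ≤ p)
    (hk : k ≤ (m + 1) / 2 + 1) (hk0 : 1 ≤ k) : Nval m p k ≤ p ^ 2 := by
  rcases Nat.lt_or_ge ((m + 1) / 2) k with h | h
  · rw [Nval_of_lt (by omega)]
    have : (k : ℤ) ≤ p := by omega
    nlinarith
  · have h1 := two_mul_Nval_of_le (p := p) h
    have h2 : (2 : ℤ) * m - 1 ≤ p := by omega
    have h3 : 2 * (k : ℤ) ≤ m + 1 := by omega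
    have h4 : (1 : ℤ) ≤ k := by omega
    have h5 : (1 : ℤ) ≤ m := by omega
    have h6 : (m - 2 * k : ℤ) * (m - 2 * k + 1) ≤ (m - 1) * m := by nlinarith
    have h7 : (m - 1 : ℤ) * m ≤ (m - 1) * p := by nlinarith
    have h8 : (2 * k : ℤ) * p ≤ (m + 1) * p := by nlinarith
    have h9 : (2 * m : ℤ) * p ≤ (p + 1) * p := by nlinarith
    nlinarith

theorem triangle_sub_le {m k : ℕ} (hk : k ≤ (m + 1) / 2) {d e : ℤ} (hd : max d (-d - 1) = m)
    (h : |e - d| ≤ 2 * k) : ((m : ℤ) - 2 * k) * (m - 2 * k + 1) ≤ e * (e + 1) := by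
  have h3 : -1 ≤ (m : ℤ) - 2 * k := by omega
  rw [abs_le] at h
  obtain ⟨c, hc⟩ : ∃ c : ℤ, c = m - 2 * k := ⟨_, rfl⟩
  rw [← hc] at h3 ⊢
  have h4 : c ≤ e ∨ c ≤ -e - 1 := by
    rcases max_choice d (-d - 1) with h' | h' <;> omega
  have hmul : ∀ e : ℤ, c ≤ e → c * (c + 1) ≤ e * (e + 1) := by
    intro e he
    rcases he.eq_or_lt with rfl | he
    · exact le_rfl
    · have : 0 ≤ (e - c) * (e + c + 1) := mul_nonneg (by omega) (by omega)
      linarith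
  rcases h4 with h4 | h4
  · exact hmul e h4
  · have := hmul _ h4
    linarith

theorem degSeq_strictMono {r : ℕ} {lam : Fin r → ℕ} (h : Antitone lam) :
    StrictMono (degSeq lam) := by
  intro i j hij
  have h1 : lam i.rev ≤ lam j.rev := h (Fin.rev_le_rev.2 hij.le)
  have h2 : (i : ℕ) < j := hij
  simp only [degSeq]
  omega

theorem two_mul_sum_degSeq {r : ℕ} (lam : Fin r → ℕ) :
    2 * ∑ i, (degSeq lam i : ℤ) = 2 * ∑ i, (lam i : ℤ) + r * (r - 1) := by
  have h1 : ∑ i : Fin r, lam i.rev = ∑ i, lam i := Equiv.sum_comp Fin.revPerm lam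
  have h2 : ∑ i : Fin r, (i : ℕ) = ∑ i ∈ range r, i := Fin.sum_univ_eq_sum_range (fun i => i) r
  have h3 := Finset.sum_range_id_mul_two r
  have h4 : ((r * (r - 1) : ℕ) : ℤ) = (r : ℤ) * (r - 1) := by cases r <;> simp
  have h5 : 2 * ∑ i, degSeq lam i = 2 * ∑ i, lam i + r * (r - 1) := by
    simp only [degSeq, sum_add_distrib]
    omega
  rw [← h4]
  exact_mod_cast h5

/-- Lemma `lem:ex_inequality`.  Suppose `m ≥ 1`, `p ≥ 2m - 1` is prime,
`0 ≤ k ≤ ⌊(m+1)/2⌋ + 1` and `n < N_k`.  Then every partition `λ ⊢ n` whose 2-core has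
size `m(m+1)/2` (i.e. `m_λ = max(d_λ, -d_λ-1) = m`) satisfies
`ν_p(F_λ) ≥ ν_p(n!) - (k - 1)`. -/
theorem stmt8 (m : ℕ) (hm : 1 ≤ m) (p : ℕ) (hp : p.Prime) (hpm : 2 * m - 1 ≤ p)
    (k : ℕ) (hk : k ≤ (m + 1) / 2 + 1)
    (n : ℕ) (hn : (n : ℤ) < Nval m p k)
    (r : ℕ) (lam : Fin r → ℕ) (hanti : Antitone lam) (hsum : ∑ i, lam i = n)
    (hcore : (dStat (degSeq lam)) ⊔ (-(dStat (degSeq lam)) - 1) = (m : ℤ)) :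
    padicValRat p (((Nat.factorial n : ℕ) : ℚ)) - ((k : ℤ) - 1) ≤ padicValRat p (Fdeg n (degSeq lam)) := by
  have : Fact p.Prime := ⟨hp⟩
  set f := degSeq lam with hf
  have hmono : StrictMono f := degSeq_strictMono hanti
  have hsumf : 2 * ∑ i, (f i : ℤ) = 2 * n + r * (r - 1) := by
    rw [hf, two_mul_sum_degSeq, ← hsum]
    push_cast
    rfl
  have hk0 : 1 ≤ k := by
    by_contra hk0
    obtain rfl : k = 0 := by omega
    have h1 := two_mul_Nval_of_le (m := m) (p := p) (k := 0) (Nat.zero_le _)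
    have h2 := card_add_dStat_le_sum hmono.injective
    have h3 := triangle_sub_le (Nat.zero_le _) hcore (e := dStat f) (k := 0) (by simp)
    simp only [Nat.cast_zero] at h1 h3
    linarith
  have hweight : ∑ i, f i / p < congrPairs p f + k := by
    by_contra! h
    obtain ⟨g, hg, hgs, hgd⟩ := exists_remove_hooks hp.pos k f hmono.injective h
    have h1 := card_add_dStat_le_sum hg
    rcases Nat.lt_or_ge ((m + 1) / 2) k with hlt | hle
    · have h2 := Nval_of_lt (m := m) (p := p) (k := k) (by omega)
      have h3 : 0 ≤ dStat g * (dStat g + 1) := by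
        rcases le_or_gt 0 (dStat g) with h | h <;> nlinarith
      linarith
    · have h2 := two_mul_Nval_of_le (p := p) hle
      have h3 := triangle_sub_le hle hcore hgd
      linarith
  have hsq := Nval_le_sq hm hp.two_le hpm hk hk0
  have hval := sum_padicValNat_factorial_le (p := p) hmono (by rw [← mul_sum]; linarith)
  have hvand : (vand f : ℚ) ≠ 0 := by
    refine Int.cast_ne_zero.2 (prod_ne_zero_iff.2 fun j _ => prod_ne_zero_iff.2 fun i hi => ?_)
    have := hmono (mem_Iio.1 hi)
    omega
  have hfac : (((∏ i, (f i).factorial : ℕ) : ℚ)) ≠ 0 := by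
    exact_mod_cast prod_ne_zero_iff.2 fun i _ => Nat.factorial_ne_zero _
  have hn0 : ((n.factorial : ℕ) : ℚ) ≠ 0 := by exact_mod_cast Nat.factorial_ne_zero n
  have hden : padicValRat p ((∏ i, (f i).factorial : ℕ) : ℚ) =
      ∑ i, (padicValNat p (f i).factorial : ℤ) := by
    rw [padicValRat.of_nat, padicValNat_prod _ _ fun i _ => Nat.factorial_ne_zero _,
      Nat.cast_sum]
  rw [Fdeg, ← Nat.cast_prod, padicValRat.div (mul_ne_zero hn0 hvand) hfac,
    padicValRat.mul hn0 hvand, hden, padicValRat_vand hmono]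
  have hweight' : ∑ i, ((f i / p : ℕ) : ℤ) < congrPairs p f + k := by exact_mod_cast hweight
  linarith
end

section
/- Let m ≥ 1 and let λ be a partition of n whose 2-core has size m(m+1)/2 (that is, m_λ = m). Let p be a prime and suppose the p-weight of λ equals t with t ≤ ⌊(m+1)/2⌋. Then n ≥ N_t = tp − t(2(m−t)+1) + m(m+1)/2. -/
open Polynomial Finset

/-- `T` is obtained from `S` (the set of entries of a degree sequence) by removing a
`p`-hook: one element `x` with `x ≥ p` and `x - p ∉ S` is replaced by `x - p`. -/
def removeHook (p : ℕ) (S T : Finset ℕ) : Prop :=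
  ∃ x ∈ S, p ≤ x ∧ x - p ∉ S ∧ T = insert (x - p) (S.erase x)

/-- There is a chain of `t` successive removals of `p`-hooks starting from `S`. -/
def hasChain (p : ℕ) : ℕ → Finset ℕ → Prop
  | 0, _ => True
  | t + 1, S => ∃ T : Finset ℕ, removeHook p S T ∧ hasChain p t T

theorem removeHook.sum_eq {p : ℕ} {S T : Finset ℕ} (h : removeHook p S T) (f : ℕ → ℤ) :
    ∃ x, p ≤ x ∧ ∑ y ∈ T, f y = ∑ y ∈ S, f y - f x + f (x - p) := by
  obtain ⟨x, hx, hpx, hxp, rfl⟩ := h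
  refine ⟨x, hpx, ?_⟩
  rw [Finset.sum_insert fun h => hxp (Finset.mem_of_mem_erase h), ← Finset.add_sum_erase S f hx]
  ring

theorem removeHook.card_eq {p : ℕ} {S T : Finset ℕ} (h : removeHook p S T) :
    T.card = S.card := by
  obtain ⟨x, -, hT⟩ := h.sum_eq fun _ => 1
  simpa using hT

theorem removeHook.sum_id_eq {p : ℕ} {S T : Finset ℕ} (h : removeHook p S T) :
    ∑ y ∈ T, (y : ℤ) = ∑ y ∈ S, (y : ℤ) - p := by
  obtain ⟨x, hx, hT⟩ := h.sum_eq fun y => (y : ℤ)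
  rw [hT]
  push_cast [hx]
  ring

/-- The number of odd elements of a finite set of natural numbers. -/
def oddCount (S : Finset ℕ) : ℕ := (S.filter Odd).card

theorem oddCount_eq_sum (S : Finset ℕ) : (oddCount S : ℤ) = ∑ y ∈ S, ((y % 2 : ℕ) : ℤ) := by
  rw [oddCount, Finset.card_filter, ← Nat.cast_sum]
  congr 1
  refine Finset.sum_congr rfl fun y _ => ?_
  split_ifs with h <;> rw [Nat.odd_iff] at h <;> omega

theorem removeHook.abs_oddCount_sub_le {p : ℕ} {S T : Finset ℕ} (h : removeHook p S T) :
    |(oddCount T : ℤ) - oddCount S| ≤ (p % 2 : ℕ) := by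
  obtain ⟨x, hx, hT⟩ := h.sum_eq fun y => ((y % 2 : ℕ) : ℤ)
  rw [oddCount_eq_sum, oddCount_eq_sum, hT, abs_le]
  omega

theorem hasChain.exists_finset {p t : ℕ} {S : Finset ℕ} (h : hasChain p t S) :
    ∃ T : Finset ℕ, T.card = S.card ∧ ∑ y ∈ T, (y : ℤ) = ∑ y ∈ S, (y : ℤ) - t * p ∧
      |(oddCount T : ℤ) - oddCount S| ≤ t * (p % 2 : ℕ) := by
  induction t generalizing S with
  | zero => exact ⟨S, rfl, by simp, by simp⟩
  | succ t ih =>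
    obtain ⟨U, hU, hUt⟩ := h
    obtain ⟨T, hcard, hsum, hodd⟩ := ih hUt
    refine ⟨T, hcard.trans hU.card_eq, ?_, ?_⟩
    · rw [hsum, hU.sum_id_eq]
      push_cast
      ring
    · calc
        _ ≤ |(oddCount T : ℤ) - oddCount U| + |(oddCount U : ℤ) - oddCount S| :=
          abs_sub_le _ _ _
        _ ≤ t * (p % 2 : ℕ) + (p % 2 : ℕ) := add_le_add hodd hU.abs_oddCount_sub_le
        _ = _ := by push_cast; ring

theorem le_sum_of_forall_mod_two_eq {e : ℕ} {S : Finset ℕ} (h : ∀ x ∈ S, x % 2 = e) :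
    (S.card : ℤ) * (S.card - 1) + e * S.card ≤ ∑ y ∈ S, (y : ℤ) := by
  induction S using Finset.induction_on_max with
  | empty => simp
  | insert x S hx ih =>
    have hxS : x ∉ S := fun h => (hx x h).false
    have hxe := h x (Finset.mem_insert_self x S)
    have hS : ∀ y ∈ S, y % 2 = e := fun y hy => h y (Finset.mem_insert_of_mem hy)
    have hcard : S.card ≤ x / 2 := by
      rw [← Finset.card_range (x / 2)]
      refine Finset.card_le_card_of_injOn (· / 2) (fun y hy => ?_) fun y hy z hz hyz => ?_
      · have := hx y hy
        have := hS y hy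
        simp only [Finset.coe_range, Set.mem_Iio]
        omega
      · have := hS y hy
        have := hS z hz
        simp only at hyz
        omega
    have hle : 2 * (S.card : ℤ) + e ≤ x := by omega
    rw [Finset.sum_insert hxS, Finset.card_insert_of_notMem hxS]
    push_cast
    linarith [ih hS]

theorem le_sum_finset (S : Finset ℕ) :
    (oddCount S : ℤ) ^ 2 + (S.card - oddCount S) * (S.card - oddCount S - 1) ≤
      ∑ y ∈ S, (y : ℤ) := by
  have hodd := le_sum_of_forall_mod_two_eq (e := 1) (S := S.filter Odd)
    fun x hx => Nat.odd_iff.mp (Finset.mem_filter.mp hx).2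
  have heven := le_sum_of_forall_mod_two_eq (e := 0) (S := S.filter (¬ Odd ·))
    fun x hx => by simpa [Nat.even_iff] using (Finset.mem_filter.mp hx).2
  have hcard : ((S.filter (¬ Odd ·)).card : ℤ) = S.card - oddCount S := by
    rw [oddCount, ← Finset.card_filter_add_card_filter_not (s := S) Odd]
    push_cast
    ring
  rw [hcard] at heven
  rw [← Finset.sum_filter_add_sum_filter_not S Odd]
  rw [← oddCount] at hodd
  push_cast at hodd heven
  linarith

theorem dStat_eq {r : ℕ} {ns : Fin r → ℕ} (h : Function.Injective ns) :
    dStat ns = 2 * oddCount (Finset.univ.image ns) - r := by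
  have hodd : oddCount (Finset.univ.image ns) = (Finset.univ.filter fun i => Odd (ns i)).card := by
    rw [oddCount, Finset.filter_image, Finset.card_image_of_injective _ h]
  have hcard := Finset.card_filter_add_card_filter_not (s := Finset.univ) fun i => Odd (ns i)
  simp only [Nat.not_odd_iff_even, Finset.card_univ, Fintype.card_fin] at hcard
  rw [dStat, hodd]
  omega

/-- Lower bound for twice the size of a 2-core whose statistic is close to that of a
2-core of size `m * (m + 1) / 2`. -/
theorem le_mul_add_one_of_abs_sub_le {m k d d' : ℤ} (hd : d ⊔ (-d - 1) = m)
    (hk : 2 * k ≤ m + 1) (h : |d' - d| ≤ 2 * k) :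
    (m - 2 * k) * (m - 2 * k + 1) ≤ d' * (d' + 1) := by
  rw [abs_le] at h
  rcases max_choice d (-d - 1) with hmax | hmax <;> rw [hmax] at hd
  · rcases (by omega : m - 2 * k = -1 ∨ 0 ≤ m - 2 * k) with h0 | h0
    · rw [h0]
      rcases (by omega : d' ≤ -1 ∨ 0 ≤ d') with h1 | h1 <;> nlinarith
    · nlinarith
  · rcases (by omega : m - 2 * k = -1 ∨ 0 ≤ m - 2 * k) with h0 | h0
    · rw [h0]
      rcases (by omega : d' ≤ -1 ∨ 0 ≤ d') with h1 | h1 <;> nlinarith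
    · nlinarith

/-- Lemma `lem:wp_bound`.  Let `m ≥ 1` and let `λ ⊢ n` have 2-core of
size `m(m+1)/2` (i.e. `m_λ = max(d_λ, -d_λ-1) = m`).  If `p` is a prime and the
`p`-weight of `λ` equals `t ≤ ⌊(m+1)/2⌋`, then `n ≥ N_t = tp - t(2(m-t)+1) + m(m+1)/2`. -/
theorem stmt9 (m : ℕ) (hm : 1 ≤ m)
    (n r : ℕ) (lam : Fin r → ℕ) (hanti : Antitone lam) (hsum : ∑ i, lam i = n)
    (hcore : (dStat (degSeq lam)) ⊔ (-(dStat (degSeq lam)) - 1) = (m : ℤ))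
    (p : ℕ) (hp : p.Prime)
    (t : ℕ) (ht : t ≤ (m + 1) / 2)
    (hchain : hasChain p t (Finset.univ.image (degSeq lam)))
    (hmax : ¬ hasChain p (t + 1) (Finset.univ.image (degSeq lam))) :
    (t : ℤ) * p - t * (2 * ((m : ℤ) - t) + 1) + m * (m + 1) / 2 ≤ (n : ℤ) := by
  have hinj := (degSeq_strictMono hanti).injective
  obtain ⟨T, hcard, hT, hodd⟩ := hchain.exists_finset
  have hle := le_sum_finset T
  have hd := dStat_eq hinj
  have hsize := two_mul_sum_degSeq lam
  rw [Finset.card_image_of_injective _ hinj, Finset.card_univ, Fintype.card_fin] at hcard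
  rw [Finset.sum_image hinj.injOn] at hT
  rw [← Nat.cast_sum Finset.univ lam, hsum] at hsize
  rw [hT, hcard] at hle
  have hbound : (2 * oddCount T - r : ℤ) * (2 * oddCount T - r + 1) ≤ 2 * (n - t * p) := by
    linarith
  have heven : (m : ℤ) * (m + 1) / 2 * 2 = m * (m + 1) :=
    Int.ediv_mul_cancel (Int.even_mul_succ_self _).two_dvd
  have habs : ∀ k : ℤ, |(oddCount T : ℤ) - oddCount (Finset.univ.image (degSeq lam))| ≤ k →
      |(2 * oddCount T - r : ℤ) - dStat (degSeq lam)| ≤ 2 * k := by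
    intro k hk
    rw [hd]
    rw [abs_le] at hk ⊢
    omega
  rcases hp.eq_two_or_odd with rfl | hp2
  · have := le_mul_add_one_of_abs_sub_le (k := 0) hcore (by omega) (habs 0 (by simpa using hodd))
    have : 0 ≤ (t : ℤ) * (2 * ((m : ℤ) - t) + 1) := mul_nonneg (by omega) (by omega)
    linarith
  · have := le_mul_add_one_of_abs_sub_le (k := t) hcore (by omega)
      (habs t (by simpa [hp2] using hodd))
    linarith
end
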